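/- arXiv:1905.06107 — 4 statements merged into one kernel-verified Lean document; each statement's English description precedes it below -/
import Mathlib

section
/- Let $n \ge 3$, $a \in (0,1)$, $d > 0$, and let $\mathrm{u}^* \in \mathbb{R}^n$ be a stationary solution of the cyclic system $d(\mathrm{u}_{i-1} - 2\mathrm{u}_i + \mathrm{u}_{i+1}) + g(\mathrm{u}_i; a) = 0$ (indices mod $n$). Then $\mathrm{u}^*$ is an asymptotically stable equilibrium of the finite-dimensional ODE $\dot{\mathrm{u}} = G(\mathrm{u}; a, d)$ on $\mathbb{R}^n$ (i.e., it is Lyapunov stable and there is $\delta > 0$ such that every solution starting within distance $\delta$ of $\mathrm{u}^*$ converges to $\mathrm{u}^*$ as $t \to \infty$) if and only if its $n$-periodic extension $u^* \in \ell^\infty(\mathbb{Z}; \mathbb{R})$ is an asymptotically stable equilibrium, with respect to the $\ell^\infty$-norm, of the lattice equation $\dot u_i = d(u_{i-1} - 2u_i + u_{i+1}) + g(u_i;a)$ posed on $\ell^\infty(\mathbb{Z};\mathbb{R})$ (i.e., Lyapunov stable and there is $\delta > 0$ such that every solution of the lattice equation with initial condition $u_0$ satisfying $\|u_0 - u^*\|_\infty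 < \delta$ converges to $u^*$ in $\ell^\infty$-norm as $t \to \infty$). -/
open Filter

/-- The cubic bistable nonlinearity `g(u; a) = u(1-u)(u-a)`. -/
noncomputable def g (a u : ℝ) : ℝ := u * (1 - u) * (u - a)

/-- The right-hand side of the Nagumo equation on the cycle graph `C_n`. -/
noncomputable def GF (n : ℕ) (a d : ℝ) (v : ZMod n → ℝ) : ZMod n → ℝ :=
  fun i => d * (v (i - 1) - 2 * v i + v (i + 1)) + g a (v i)

/-- A solution (for `t ≥ 0`) of the graph Nagumo ODE `u' = G(u; a, d)` on `ℝⁿ`. -/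
def IsODESol (n : ℕ) [NeZero n] (a d : ℝ) (V : ℝ → ZMod n → ℝ) : Prop :=
  ∀ t : ℝ, 0 ≤ t → HasDerivAt V (GF n a d (V t)) t

/-- Asymptotic stability of an equilibrium `p` of the graph Nagumo ODE on `ℝⁿ`:
Lyapunov stability together with local attractivity. -/
def ODEAsympStable (n : ℕ) [NeZero n] (a d : ℝ) (p : ZMod n → ℝ) : Prop :=
  (∀ ε > 0, ∃ δ > 0, ∀ V : ℝ → ZMod n → ℝ, IsODESol n a d V → ‖V 0 - p‖ < δ →
      ∀ t : ℝ, 0 ≤ t → ‖V t - p‖ < ε) ∧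
  ∃ δ > 0, ∀ V : ℝ → ZMod n → ℝ, IsODESol n a d V → ‖V 0 - p‖ < δ →
      Tendsto V atTop (nhds p)

/-- A solution (for `t ≥ 0`) of the lattice Nagumo equation, viewed as a differentiable
curve in `ℓ^∞(ℤ; ℝ)` satisfying the equation componentwise. -/
def IsLDESol (a d : ℝ) (U : ℝ → lp (fun _ : ℤ => ℝ) ⊤) : Prop :=
  ∀ t : ℝ, 0 ≤ t → ∃ U' : lp (fun _ : ℤ => ℝ) ⊤, HasDerivAt U U' t ∧
    ∀ i : ℤ, U' i = d * (U t (i - 1) - 2 * U t i + U t (i + 1)) + g a (U t i)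

/-- Asymptotic stability of an equilibrium `p ∈ ℓ^∞(ℤ;ℝ)` of the lattice Nagumo
equation, with respect to the `ℓ^∞`-norm. -/
def LDEAsympStable (a d : ℝ) (p : lp (fun _ : ℤ => ℝ) ⊤) : Prop :=
  (∀ ε > 0, ∃ δ > 0, ∀ U : ℝ → lp (fun _ : ℤ => ℝ) ⊤, IsLDESol a d U → ‖U 0 - p‖ < δ →
      ∀ t : ℝ, 0 ≤ t → ‖U t - p‖ < ε) ∧
  ∃ δ > 0, ∀ U : ℝ → lp (fun _ : ℤ => ℝ) ⊤, IsLDESol a d U → ‖U 0 - p‖ < δ →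
      Tendsto U atTop (nhds p)

open Set Metric Topology
open scoped NNReal

section GlobalExistence

variable {E : Type*} [NormedAddCommGroup E] [NormedSpace ℝ E] [CompleteSpace E]

/-- A bounded, globally Lipschitz autonomous vector field has a global integral curve through
every point. -/
theorem exists_forall_hasDerivAt_of_lipschitzWith_of_norm_le {f : E → E} {K L : ℝ≥0}
    (hK : LipschitzWith K f) (hL : ∀ x, ‖f x‖ ≤ L) (x₀ : E) :
    ∃ γ : ℝ → E, γ 0 = x₀ ∧ ∀ t, HasDerivAt γ (f (γ t)) t := by
  have local_curve (T : ℝ) (hT : 0 < T) :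
      ∃ γ : ℝ → E, γ 0 = x₀ ∧ ∀ t ∈ Ioo (-T) T, HasDerivAt γ (f (γ t)) t := by
    have hpl : IsPicardLindelof (fun _ ↦ f) (tmin := -T) (tmax := T)
        ⟨0, by simp [hT.le]⟩ x₀ (L * T.toNNReal) 0 L K :=
      .of_time_independent (fun x _ ↦ hL x) hK.lipschitzOnWith (by simp [hT.le])
    obtain ⟨γ, hγ₀, hγ⟩ := hpl.exists_eq_forall_mem_Icc_hasDerivWithinAt₀
    exact ⟨γ, hγ₀, fun t ht ↦
      (hγ t (Ioo_subset_Icc_self ht)).hasDerivAt (Icc_mem_nhds ht.1 ht.2)⟩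
  choose! γ hγ₀ hγ using local_curve
  have agree {S T : ℝ} (hS : 0 < S) (hST : S ≤ T) : EqOn (γ S) (γ T) (Ioo (-S) S) :=
    ODE_solution_unique_of_mem_Ioo (v := fun _ ↦ f) (s := fun _ ↦ univ) (K := K) (t₀ := 0)
      (fun _ _ ↦ hK.lipschitzOnWith) (by simp [hS])
      (fun t ht ↦ ⟨hγ S hS t ht, mem_univ _⟩)
      (fun t ht ↦ ⟨hγ T (hS.trans_le hST) t ⟨by linarith [ht.1], by linarith [ht.2]⟩, mem_univ _⟩)
      (by rw [hγ₀ S hS, hγ₀ T (hS.trans_le hST)])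
  have mem_Ioo_abs (t : ℝ) : t ∈ Ioo (-(|t| + 1)) (|t| + 1) := abs_lt.mp (lt_add_one _)
  refine ⟨fun t ↦ γ (|t| + 1) t, hγ₀ _ (by positivity), fun t ↦ ?_⟩
  refine (hγ (|t| + 1) (by positivity) t (mem_Ioo_abs t)).congr_of_eventuallyEq ?_
  filter_upwards [Ioo_mem_nhds (mem_Ioo_abs t).1 (mem_Ioo_abs t).2] with s hs
  rcases le_total |s| |t| with h | h
  · exact agree (by positivity) (by linarith) (mem_Ioo_abs s)
  · exact (agree (by positivity) (by linarith) hs).symm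

end GlobalExistence

section Truncation

variable {ι : Type*}

/-- Componentwise truncation of a vector to the interval `[-M, M]`. -/
def clamp (M : ℝ) (x : ι → ℝ) : ι → ℝ := fun i ↦ max (-M) (min M (x i))

theorem clamp_le {M : ℝ} (hM : 0 ≤ M) (x : ι → ℝ) (i : ι) : clamp M x i ≤ M :=
  max_le (by linarith) (min_le_left _ _)

theorem neg_le_clamp (M : ℝ) (x : ι → ℝ) (i : ι) : -M ≤ clamp M x i :=
  le_max_left _ _

theorem clamp_apply_of_mem {M : ℝ} {x : ι → ℝ} {i : ι} (h₁ : -M ≤ x i) (h₂ : x i ≤ M) :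
    clamp M x i = x i := by
  simp [clamp, h₁, h₂]

variable [Fintype ι]

theorem lipschitzWith_clamp (M : ℝ) : LipschitzWith 1 (clamp M : (ι → ℝ) → ι → ℝ) := by
  refine LipschitzWith.of_dist_le_mul fun x y ↦ ?_
  rw [NNReal.coe_one, one_mul, dist_pi_le_iff dist_nonneg]
  intro i
  refine le_trans ?_ (dist_le_pi_dist x y i)
  simp only [clamp, Real.dist_eq]
  rw [max_comm (-M), max_comm (-M), min_comm M, min_comm M]
  exact (abs_sup_sub_sup_le_abs _ _ _).trans (abs_inf_sub_inf_le_abs _ _ _)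

theorem clamp_mem_closedBall {M : ℝ} (hM : 0 ≤ M) (x : ι → ℝ) :
    clamp M x ∈ closedBall (0 : ι → ℝ) M := by
  rw [mem_closedBall_zero_iff, pi_norm_le_iff_of_nonneg hM]
  exact fun i ↦ abs_le.mpr ⟨neg_le_clamp M x i, clamp_le hM x i⟩

end Truncation

/-- A differentiable function with negative derivative wherever it takes the value `M` cannot
cross the level `M` upwards. -/
theorem le_of_hasDerivAt_neg_of_eq {φ φ' : ℝ → ℝ} {M : ℝ} (hφ : ∀ t, HasDerivAt φ (φ' t) t)
    (h₀ : φ 0 ≤ M) (hM : ∀ t, φ t = M → φ' t < 0) {t : ℝ} (ht : 0 ≤ t) : φ t ≤ M :=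
  image_le_of_deriv_right_lt_deriv_boundary (B := fun _ ↦ M) (B' := fun _ ↦ 0)
    (fun s _ ↦ (hφ s).continuousAt.continuousWithinAt) (fun s _ ↦ (hφ s).hasDerivWithinAt) h₀
    (fun s ↦ hasDerivAt_const s M) (fun s _ ↦ hM s) (right_mem_Icc.mpr ht)

theorem contDiff_GF (n : ℕ) [NeZero n] (a d : ℝ) : ContDiff ℝ 1 (GF n a d) := by
  unfold GF g
  fun_prop

/-- Every initial value of the graph Nagumo equation has a global forward solution. -/
theorem exists_isODESol (n : ℕ) [NeZero n] {a d : ℝ} (hd : 0 ≤ d) (x₀ : ZMod n → ℝ) :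
    ∃ V, IsODESol n a d V ∧ V 0 = x₀ := by
  set M : ℝ := 2 + |a| + ‖x₀‖ with hM_def
  have hM : 2 ≤ M := by have := abs_nonneg a; have := norm_nonneg x₀; linarith
  have haM : |a| < M := by have := norm_nonneg x₀; linarith
  have haM' := abs_lt.mp haM
  obtain ⟨K, hK⟩ :=
    (contDiff_GF n a d).locallyLipschitz.locallyLipschitzOn.exists_lipschitzOnWith_of_compact
      (isCompact_closedBall (0 : ZMod n → ℝ) M)
  obtain ⟨L, hL⟩ := (isCompact_closedBall (0 : ZMod n → ℝ) M).exists_bound_of_continuousOn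
    (contDiff_GF n a d).continuous.continuousOn
  have hlip : LipschitzWith (K * 1) (GF n a d ∘ clamp M) := lipschitzOnWith_univ.mp <|
    hK.comp (lipschitzWith_clamp M).lipschitzOnWith
      fun x _ ↦ clamp_mem_closedBall (by linarith) x
  obtain ⟨V, hV₀, hV⟩ := exists_forall_hasDerivAt_of_lipschitzWith_of_norm_le (L := L.toNNReal)
    hlip (fun x ↦ (hL _ (clamp_mem_closedBall (by linarith) x)).trans (le_max_left _ _)) x₀
  have hV' (t : ℝ) (i : ZMod n) := hasDerivAt_pi.mp (hV t) i
  have h₀ (i : ZMod n) : |V 0 i| ≤ M := by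
    rw [hV₀]
    exact (norm_le_pi_norm x₀ i).trans (by have := abs_nonneg a; linarith)
  have upper (t : ℝ) (ht : 0 ≤ t) (i : ZMod n) : V t i ≤ M := by
    refine le_of_hasDerivAt_neg_of_eq (hV' · i) (abs_le.mp (h₀ i)).2 (fun s hs ↦ ?_) ht
    have hi : clamp M (V s) i = M := by
      rw [clamp_apply_of_mem (by linarith) hs.le, hs]
    have h₁ := clamp_le (by linarith : 0 ≤ M) (V s) (i - 1)
    have h₂ := clamp_le (by linarith : 0 ≤ M) (V s) (i + 1)
    have hg : g a M < 0 :=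
      mul_neg_of_neg_of_pos (mul_neg_of_pos_of_neg (by linarith) (by linarith)) (by linarith)
    simp only [Function.comp_apply, GF, hi]
    nlinarith
  have lower (t : ℝ) (ht : 0 ≤ t) (i : ZMod n) : -M ≤ V t i := by
    refine neg_le.mp <| le_of_hasDerivAt_neg_of_eq (fun s ↦ (hV' s i).fun_neg)
      (by linarith [(abs_le.mp (h₀ i)).1]) (fun s hs ↦ ?_) ht
    have hi : clamp M (V s) i = -M := by
      rw [clamp_apply_of_mem (by linarith) (by linarith)]; linarith
    have h₁ := neg_le_clamp M (V s) (i - 1)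
    have h₂ := neg_le_clamp M (V s) (i + 1)
    have hg : 0 < g a (-M) :=
      mul_pos_of_neg_of_neg (mul_neg_of_neg_of_pos (by linarith) (by linarith)) (by linarith)
    simp only [Function.comp_apply, GF, hi]
    nlinarith
  refine ⟨V, fun t ht ↦ ?_, hV₀⟩
  have hclamp : clamp M (V t) = V t :=
    funext fun i ↦ clamp_apply_of_mem (lower t ht i) (upper t ht i)
  simpa [hclamp] using hV t

section PeriodicExtension

/-- The `n`-periodic extension of a function on the cycle, as an isometric embedding into
`ℓ^∞(ℤ; ℝ)`. -/
noncomputable def periodicExtension (n : ℕ) [NeZero n] :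
    (ZMod n → ℝ) →ₗᵢ[ℝ] lp (fun _ : ℤ => ℝ) ⊤ where
  toFun x := ⟨fun i ↦ x (i : ZMod n), memℓp_infty ⟨‖x‖, by
    rintro _ ⟨i, rfl⟩
    exact norm_le_pi_norm x _⟩⟩
  map_add' _ _ := rfl
  map_smul' _ _ := rfl
  norm_map' x := by
    refine le_antisymm (lp.norm_le_of_forall_le (norm_nonneg x) fun i ↦ norm_le_pi_norm x _)
      ((pi_norm_le_iff_of_nonneg (norm_nonneg _)).mpr fun i ↦ ?_)
    obtain ⟨k, rfl⟩ := ZMod.intCast_surjective i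
    exact lp.norm_apply_le_norm ENNReal.top_ne_zero
      (⟨fun i ↦ x (i : ZMod n), _⟩ : lp (fun _ : ℤ => ℝ) ⊤) k

@[simp]
theorem periodicExtension_apply (n : ℕ) [NeZero n] (x : ZMod n → ℝ) (i : ℤ) :
    periodicExtension n x i = x (i : ZMod n) := rfl

theorem IsODESol.isLDESol_periodicExtension {n : ℕ} [NeZero n] {a d : ℝ} {V : ℝ → ZMod n → ℝ}
    (hV : IsODESol n a d V) : IsLDESol a d fun t ↦ periodicExtension n (V t) := fun t ht ↦
  ⟨periodicExtension n (GF n a d (V t)),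
    (periodicExtension n).toContinuousLinearMap.hasFDerivAt.comp_hasDerivAt t (hV t ht),
    fun i ↦ by simp [GF]⟩

end PeriodicExtension

section Comparison

/-- On bounded sets, the difference of two values of the cubic `g` is a bounded multiple of the
difference of the arguments. -/
theorem exists_g_sub_g_eq_mul (a R : ℝ) : ∃ C, 0 ≤ C ∧ ∀ x y, |x| ≤ R → |y| ≤ R →
    ∃ q, |q| ≤ C ∧ g a x - g a y = q * (x - y) := by
  refine ⟨abs (3 * R ^ 2 + 2 * |1 + a| * R + |a|), abs_nonneg _, fun x y hx hy ↦
    ⟨-(x ^ 2 + x * y + y ^ 2) + (1 + a) * (x + y) - a, le_trans ?_ (le_abs_self _), by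
      unfold g; ring⟩⟩
  have hR : 0 ≤ R := (abs_nonneg x).trans hx
  calc |-(x ^ 2 + x * y + y ^ 2) + (1 + a) * (x + y) - a|
      ≤ |x| ^ 2 + |x| * |y| + |y| ^ 2 + |1 + a| * (|x| + |y|) + |a| := by
        refine (abs_sub _ _).trans ?_
        gcongr
        refine (abs_add_le _ _).trans ?_
        rw [abs_neg, abs_mul (1 + a), ← abs_pow, ← abs_pow, ← abs_mul x y]
        gcongr
        · exact abs_add_three _ _ _
        · exact abs_add_le _ _
    _ ≤ R ^ 2 + R * R + R ^ 2 + |1 + a| * (R + R) + |a| := by gcongr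
    _ = _ := by ring

theorem IsLDESol.continuousOn {a d : ℝ} {U : ℝ → lp (fun _ : ℤ => ℝ) ⊤} (hU : IsLDESol a d U) :
    ContinuousOn U (Ici 0) := fun t ht ↦
  have ⟨_, h, _⟩ := hU t ht
  h.continuousAt.continuousWithinAt

theorem IsLDESol.exists_abs_le {a d : ℝ} {U : ℝ → lp (fun _ : ℤ => ℝ) ⊤} (hU : IsLDESol a d U)
    (T : ℝ) : ∃ R, ∀ t ∈ Icc 0 T, ∀ i, |U t i| ≤ R := by
  obtain ⟨R, hR⟩ := isCompact_Icc.exists_bound_of_continuousOn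
    (hU.continuousOn.mono (Icc_subset_Ici_self : Icc 0 T ⊆ Ici 0))
  exact ⟨R, fun t ht i ↦ (lp.norm_apply_le_norm ENNReal.top_ne_zero _ i).trans (hR t ht)⟩

/-- Quantitative comparison: the excess of a solution over one that starts above it stays below
every positive exponential with sufficiently large rate. -/
theorem IsLDESol.sub_le_exp {a d : ℝ} (hd : 0 ≤ d) {U V : ℝ → lp (fun _ : ℤ => ℝ) ⊤}
    (hU : IsLDESol a d U) (hV : IsLDESol a d V) (h₀ : ∀ i, U 0 i ≤ V 0 i) (T : ℝ) :
    ∃ K, ∀ ε > 0, ∀ t ∈ Icc 0 T, ∀ i, U t i - V t i ≤ ε * Real.exp (K * t) := by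
  obtain ⟨R₁, hR₁⟩ := hU.exists_abs_le T
  obtain ⟨R₂, hR₂⟩ := hV.exists_abs_le T
  obtain ⟨C, hC₀, hC⟩ := exists_g_sub_g_eq_mul a (max R₁ R₂)
  refine ⟨C + 1, fun ε hε ↦ ?_⟩
  set B : ℝ → ℝ := fun t ↦ ε * Real.exp ((C + 1) * t)
  have hB (t : ℝ) : 0 < B t := by positivity
  have hBstep (t h : ℝ) : B t * (1 + (C + 1) * h) ≤ B (t + h) := by
    have hexp : B (t + h) = B t * Real.exp ((C + 1) * h) := by
      simp only [B, mul_add, Real.exp_add]; ring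
    rw [hexp]
    have := Real.add_one_le_exp ((C + 1) * h)
    exact mul_le_mul_of_nonneg_left (by linarith) (hB t).le
  have heval (W : ℝ → lp (fun _ : ℤ => ℝ) ⊤) (hW : IsLDESol a d W) (i : ℤ) :
      ContinuousOn (fun t ↦ W t i) (Icc 0 T) :=
    (lp.lipschitzWith_one_eval _ i).continuous.comp_continuousOn
      (hW.continuousOn.mono Icc_subset_Ici_self)
  suffices Icc 0 T ⊆ {t | ∀ i, U t i - V t i ≤ B t} from this
  refine IsClosed.Icc_subset_of_forall_exists_gt ?_
    (fun i ↦ by linarith [h₀ i, hB 0]) fun t ⟨ht, htT⟩ y hy ↦ ?_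
  · have : {t | ∀ i, U t i - V t i ≤ B t} ∩ Icc 0 T =
        ⋂ i : ℤ, {t ∈ Icc 0 T | U t i - V t i ≤ B t} := by
      ext t; simp only [mem_inter_iff, mem_ofPred_eq, mem_iInter]
      exact ⟨fun h i ↦ ⟨h.2, h.1 i⟩, fun h ↦ ⟨fun i ↦ (h i).2, (h 0).1⟩⟩
    rw [this]
    refine isClosed_iInter fun i ↦
      isClosed_Icc.isClosed_le ((heval U hU i).sub (heval V hV i)) ?_
    fun_prop
  obtain ⟨U', hU', hU'eq⟩ := hU t htT.1
  obtain ⟨V', hV', hV'eq⟩ := hV t htT.1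
  have hsmall := (hasDerivAt_iff_isLittleO_nhds_zero.mp (hU'.sub hV')).def (hB t)
  have hpos : 0 < (1 + 2 * d + C)⁻¹ := by positivity
  have hnear := hsmall.and ((eventually_lt_nhds hpos).and (eventually_lt_nhds (sub_pos.mpr hy)))
  obtain ⟨h, ⟨hh, hh₁, hh₂⟩, h_pos : 0 < h⟩ :=
    ((hnear.filter_mono (nhdsWithin_le_nhds (s := Ioi 0))).and self_mem_nhdsWithin).exists
  refine ⟨t + h, fun i ↦ ?_, by linarith, by linarith⟩
  obtain ⟨q, hqC, hq⟩ := hC (U t i) (V t i)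
    ((hR₁ t ⟨htT.1, htT.2.le⟩ i).trans (le_max_left _ _))
    ((hR₂ t ⟨htT.1, htT.2.le⟩ i).trans (le_max_right _ _))
  have happ := (lp.norm_apply_le_norm ENNReal.top_ne_zero
    ((U - V) (t + h) - (U - V) t - h • (U' - V')) i).trans hh
  simp only [Pi.sub_apply, lp.coeFn_sub, lp.coeFn_smul, Pi.smul_apply, smul_eq_mul,
    Real.norm_eq_abs, abs_of_pos h_pos, hU'eq, hV'eq] at happ
  have hstep := (abs_le.mp happ).2
  have hcoef : 0 ≤ 1 - 2 * d * h + q * h := by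
    have h1 : (1 + 2 * d + C) * h ≤ 1 := by
      rw [← le_inv_mul_iff₀ (by positivity), mul_one]; exact hh₁.le
    nlinarith [(abs_le.mp hqC).1]
  have hleft := mul_le_mul_of_nonneg_left (ht (i - 1)) (by positivity : 0 ≤ d * h)
  have hright := mul_le_mul_of_nonneg_left (ht (i + 1)) (by positivity : 0 ≤ d * h)
  have hself := mul_le_mul_of_nonneg_left (ht i) hcoef
  have hqB : q * (h * B t) ≤ C * (h * B t) :=
    mul_le_mul_of_nonneg_right (abs_le.mp hqC).2 (mul_pos h_pos (hB t)).le
  have hgh : h * (g a (U t i) - g a (V t i)) = h * (q * (U t i - V t i)) := by rw [hq]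
  linarith [hBstep t h]

/-- Comparison principle for the lattice Nagumo equation. -/
theorem IsLDESol.le_of_le_zero {a d : ℝ} (hd : 0 ≤ d) {U V : ℝ → lp (fun _ : ℤ => ℝ) ⊤}
    (hU : IsLDESol a d U) (hV : IsLDESol a d V) (h₀ : ∀ i, U 0 i ≤ V 0 i) {t : ℝ} (ht : 0 ≤ t)
    (i : ℤ) : U t i ≤ V t i := by
  obtain ⟨K, hK⟩ := hU.sub_le_exp hd hV h₀ t
  refine le_of_forall_pos_le_add fun ε hε ↦ ?_
  have := hK (ε * Real.exp (-(K * t))) (by positivity) t (right_mem_Icc.mpr ht) i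
  rw [mul_assoc, ← Real.exp_add, neg_add_cancel, Real.exp_zero, mul_one] at this
  linarith

end Comparison

section Stability

variable {n : ℕ} [NeZero n] {a d : ℝ} {v : ZMod n → ℝ}

theorem LDEAsympStable.odeAsympStable (h : LDEAsympStable a d (periodicExtension n v)) :
    ODEAsympStable n a d v := by
  have hnorm (x : ZMod n → ℝ) :
      ‖periodicExtension n x - periodicExtension n v‖ = ‖x - v‖ := by
    rw [← map_sub, LinearIsometry.norm_map]
  obtain ⟨hstab, δ, hδ, hattr⟩ := h
  refine ⟨fun ε hε ↦ ?_, δ, hδ, fun V hV hV₀ ↦ ?_⟩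
  · obtain ⟨δ, hδ, H⟩ := hstab ε hε
    refine ⟨δ, hδ, fun V hV hV₀ t ht ↦ ?_⟩
    rw [← hnorm]
    exact H _ hV.isLDESol_periodicExtension (by rwa [hnorm]) t ht
  · rw [(periodicExtension n).isometry.isEmbedding.tendsto_nhds_iff]
    exact hattr _ hV.isLDESol_periodicExtension (by rwa [Function.comp_apply, hnorm])

/-- Any `δ`-neighbourhood of `v` contains initial values of two graph solutions such that every
lattice solution starting near the periodic extension of `v` is squeezed between them. -/
theorem exists_squeezing_solutions (hd : 0 ≤ d) (v : ZMod n → ℝ) {δ : ℝ} (hδ : 0 < δ) :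
    ∃ V W : ℝ → ZMod n → ℝ, IsODESol n a d V ∧ IsODESol n a d W ∧
      ‖V 0 - v‖ < δ ∧ ‖W 0 - v‖ < δ ∧
      ∀ U, IsLDESol a d U → ‖U 0 - periodicExtension n v‖ < δ / 2 → ∀ t, 0 ≤ t →
        ‖U t - periodicExtension n v‖ ≤ max ‖V t - v‖ ‖W t - v‖ := by
  obtain ⟨V, hV, hV₀⟩ := exists_isODESol n (a := a) hd (fun i ↦ v i - δ / 2)
  obtain ⟨W, hW, hW₀⟩ := exists_isODESol n (a := a) hd (fun i ↦ v i + δ / 2)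
  refine ⟨V, W, hV, hW, ?_, ?_, fun U hU hU₀ t ht ↦ ?_⟩
  · rw [hV₀, pi_norm_lt_iff hδ]
    intro i
    rw [Pi.sub_apply, Real.norm_eq_abs, abs_lt]
    constructor <;> linarith
  · rw [hW₀, pi_norm_lt_iff hδ]
    intro i
    rw [Pi.sub_apply, Real.norm_eq_abs, abs_lt]
    constructor <;> linarith
  have hclose (i : ℤ) : |U 0 i - v i| < δ / 2 :=
    (lp.norm_apply_le_norm ENNReal.top_ne_zero (U 0 - periodicExtension n v) i).trans_lt hU₀
  refine lp.norm_le_of_forall_le' _ fun i ↦ ?_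
  have hVU : V t i ≤ U t i := hV.isLDESol_periodicExtension.le_of_le_zero hd hU
    (fun j ↦ by
      simp only [periodicExtension_apply, hV₀]
      linarith [(abs_lt.mp (hclose j)).1]) ht i
  have hUW : U t i ≤ W t i := hU.le_of_le_zero hd hW.isLDESol_periodicExtension
    (fun j ↦ by
      simp only [periodicExtension_apply, hW₀]
      linarith [(abs_lt.mp (hclose j)).2]) ht i
  calc |U t i - v i| ≤ max |V t i - v i| |W t i - v i| :=
        abs_le_max_abs_abs (by linarith) (by linarith)
    _ ≤ max ‖V t - v‖ ‖W t - v‖ :=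
        max_le_max (norm_le_pi_norm (V t - v) i) (norm_le_pi_norm (W t - v) i)

theorem ODEAsympStable.ldeAsympStable (hd : 0 ≤ d) (h : ODEAsympStable n a d v) :
    LDEAsympStable a d (periodicExtension n v) := by
  obtain ⟨hstab, δ, hδ, hattr⟩ := h
  refine ⟨fun ε hε ↦ ?_, δ / 2, half_pos hδ, fun U hU hU₀ ↦ ?_⟩
  · obtain ⟨δ, hδ, H⟩ := hstab ε hε
    obtain ⟨V, W, hV, hW, hV₀, hW₀, hsq⟩ := exists_squeezing_solutions (a := a) hd v hδ
    exact ⟨δ / 2, half_pos hδ, fun U hU hU₀ t ht ↦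
      (hsq U hU hU₀ t ht).trans_lt (max_lt (H V hV hV₀ t ht) (H W hW hW₀ t ht))⟩
  · obtain ⟨V, W, hV, hW, hV₀, hW₀, hsq⟩ := exists_squeezing_solutions (a := a) hd v hδ
    have hlim := (tendsto_iff_norm_sub_tendsto_zero.mp (hattr V hV hV₀)).max
      (tendsto_iff_norm_sub_tendsto_zero.mp (hattr W hW hW₀))
    rw [max_self] at hlim
    refine tendsto_iff_norm_sub_tendsto_zero.mpr
      (squeeze_zero' (.of_forall fun _ ↦ norm_nonneg _) ?_ hlim)
    filter_upwards [eventually_ge_atTop 0] with t ht using hsq U hU hU₀ t ht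

end Stability

/-- A stationary solution of the Nagumo equation on the cycle `C_n` is asymptotically
stable for the finite-dimensional ODE if and only if its `n`-periodic extension is an
asymptotically stable equilibrium of the lattice Nagumo equation on `ℓ^∞(ℤ;ℝ)`. -/
theorem odeAsympStable_iff_ldeAsympStable
    (n : ℕ) [NeZero n] (hn : 3 ≤ n) (a : ℝ) (ha : a ∈ Set.Ioo (0:ℝ) 1)
    (d : ℝ) (hd : 0 < d) (v : ZMod n → ℝ)
    (hv : ∀ i : ZMod n, GF n a d v i = 0)
    (p : lp (fun _ : ℤ => ℝ) ⊤) (hp : ∀ i : ℤ, p i = v (i : ZMod n)) :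
    ODEAsympStable n a d v ↔ LDEAsympStable a d p := by
  obtain rfl : p = periodicExtension n v := lp.ext (funext hp)
  exact ⟨ODEAsympStable.ldeAsympStable hd.le, LDEAsympStable.odeAsympStable⟩
end

section
/- Fix $n \ge 3$ and $a \in (0,1)$. There exists $d_0 > 0$ such that for every $d \in (0, d_0)$, the set of $n$-periodic stationary solutions of the lattice Nagumo equation, i.e., the set of sequences $u : \mathbb{Z} \to \mathbb{R}$ with $u_{i+n} = u_i$ and $d(u_{i-1} - 2u_i + u_{i+1}) + g(u_i; a) = 0$ for all $i \in \mathbb{Z}$, has exactly $3^n$ elements. -/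
/-- The discrete Laplacian of a function on the cyclic group `ZMod n`. -/
def cyclicLaplacian {n : ℕ} (v : ZMod n → ℝ) (i : ZMod n) : ℝ :=
  v (i - 1) - 2 * v i + v (i + 1)

/-- The stationary Nagumo equation on the cyclic group `ZMod n`. -/
def IsCyclicStationary {n : ℕ} (a d : ℝ) (v : ZMod n → ℝ) : Prop :=
  ∀ i, d * cyclicLaplacian v i + g a (v i) = 0

/-- The derivative of the bistable nonlinearity at `r`. -/
def nagumoSlope (a r : ℝ) : ℝ := -3 * r ^ 2 + 2 * (1 + a) * r - a

theorem abs_cyclicLaplacian_sub_le {n : ℕ} [NeZero n] (u v : ZMod n → ℝ) (i : ZMod n) :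
    |cyclicLaplacian u i - cyclicLaplacian v i| ≤ 4 * dist u v := by
  have h (j : ZMod n) := abs_le.1 ((Real.dist_eq _ _).symm.le.trans (dist_le_pi_dist u v j))
  have h₁ := h (i - 1)
  have h₂ := h i
  have h₃ := h (i + 1)
  rw [abs_le]
  unfold cyclicLaplacian
  constructor <;> linarith [h₁.1, h₁.2, h₂.1, h₂.2, h₃.1, h₃.2]

/-- Near `r`, the nonlinearity is close to its linearization in the Lipschitz sense. -/
theorem abs_g_sub_slope_mul_le {a r ε x y : ℝ} (ha : a ∈ Set.Ioo (0 : ℝ) 1)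
    (hr : r ∈ Set.Icc (0 : ℝ) 1) (hε : ε ≤ 1) (hx : |x - r| ≤ ε) (hy : |y - r| ≤ ε) :
    |g a x - g a y - nagumoSlope a r * (x - y)| ≤ 13 * ε * |x - y| := by
  obtain ⟨p, rfl⟩ : ∃ p, x = r + p := ⟨x - r, by ring⟩
  obtain ⟨q, rfl⟩ : ∃ q, y = r + q := ⟨y - r, by ring⟩
  simp only [add_sub_cancel_left] at hx hy
  have hε0 : 0 ≤ ε := (abs_nonneg p).trans hx
  have key : g a (r + p) - g a (r + q) - nagumoSlope a r * (r + p - (r + q)) =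
      ((1 + a - 3 * r) * (p + q) - (p * p + p * q + q * q)) *
        (r + p - (r + q)) := by
    unfold g nagumoSlope; ring
  rw [key, abs_mul]
  refine mul_le_mul_of_nonneg_right ?_ (abs_nonneg _)
  have h₁ : |1 + a - 3 * r| ≤ 3 := by
    rw [abs_le]; constructor <;> linarith [ha.1, ha.2, hr.1, hr.2]
  have h₂ : |p + q| ≤ 2 * ε := (abs_add_le p q).trans (by linarith)
  have h₃ : |(1 + a - 3 * r) * (p + q)| ≤ 3 * (2 * ε) := by
    rw [abs_mul]; gcongr
  have hmul {s t : ℝ} (hs : |s| ≤ ε) (ht : |t| ≤ ε) : |s * t| ≤ ε := by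
    rw [abs_mul]
    calc |s| * |t| ≤ ε * 1 := by gcongr; exact ht.trans hε
      _ = ε := mul_one ε
  have h₄ := abs_le.1 (hmul hx hx)
  have h₅ := abs_le.1 (hmul hx hy)
  have h₆ := abs_le.1 (hmul hy hy)
  have h₇ := abs_le.1 h₃
  rw [abs_le]
  constructor <;> linarith [h₄.1, h₄.2, h₅.1, h₅.2, h₆.1, h₆.2, h₇.1, h₇.2]

/-- The zeros of the nonlinearity are nondegenerate. -/
theorem le_abs_nagumoSlope {a r : ℝ} (ha : a ∈ Set.Ioo (0 : ℝ) 1)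
    (hr : r ∈ ({0, a, 1} : Finset ℝ)) : a * (1 - a) ≤ |nagumoSlope a r| := by
  obtain ⟨h0, h1⟩ := ha
  simp only [Finset.mem_insert, Finset.mem_singleton] at hr
  unfold nagumoSlope
  rcases hr with rfl | rfl | rfl
  · exact le_abs.2 (Or.inr (by nlinarith))
  · exact le_abs.2 (Or.inl (by nlinarith))
  · exact le_abs.2 (Or.inr (by nlinarith))

theorem mem_Icc_of_mem_roots {a r : ℝ} (ha : a ∈ Set.Ioo (0 : ℝ) 1)
    (hr : r ∈ ({0, a, 1} : Finset ℝ)) : r ∈ Set.Icc (0 : ℝ) 1 := by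
  obtain ⟨h0, h1⟩ := ha
  simp only [Finset.mem_insert, Finset.mem_singleton] at hr
  rcases hr with rfl | rfl | rfl <;> constructor <;> linarith

theorem g_eq_zero_of_mem_roots {a r : ℝ} (hr : r ∈ ({0, a, 1} : Finset ℝ)) : g a r = 0 := by
  simp only [Finset.mem_insert, Finset.mem_singleton] at hr
  rcases hr with rfl | rfl | rfl <;> simp [g]

/-- Distinct zeros of the nonlinearity are at distance at least `a (1 - a)`. -/
theorem eq_of_abs_sub_lt_of_mem_roots {a r s : ℝ} (ha : a ∈ Set.Ioo (0 : ℝ) 1)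
    (hr : r ∈ ({0, a, 1} : Finset ℝ)) (hs : s ∈ ({0, a, 1} : Finset ℝ))
    (h : |r - s| < a * (1 - a)) : r = s := by
  obtain ⟨h0, h1⟩ := ha
  simp only [Finset.mem_insert, Finset.mem_singleton] at hr hs
  rw [abs_lt] at h
  rcases hr with rfl | rfl | rfl <;> rcases hs with rfl | rfl | rfl <;>
    first
    | rfl
    | (exfalso; nlinarith [h.1, h.2])

/-- A point where the nonlinearity is small is close to one of its zeros. -/
theorem exists_root_near {a x ε : ℝ} (hε : 0 ≤ ε) (h : |g a x| ≤ ε ^ 3) :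
    ∃ r ∈ ({0, a, 1} : Finset ℝ), |x - r| ≤ ε := by
  by_contra! hfar
  have h₀ := hfar 0 (by simp)
  have h₁ := hfar a (by simp)
  have h₂ := hfar 1 (by simp)
  rw [sub_zero] at h₀
  rw [abs_sub_comm] at h₂
  have : ε * ε * ε < |x| * |1 - x| * |x - a| := by gcongr
  rw [g, abs_mul, abs_mul] at h
  linarith [show ε ^ 3 = ε * ε * ε by ring]

/-- Maximum principle: stationary solutions take values in `[0, 1]`. -/
theorem IsCyclicStationary.mem_Icc {n : ℕ} [NeZero n] {a d : ℝ} {v : ZMod n → ℝ}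
    (ha : a ∈ Set.Ioo (0 : ℝ) 1) (hd : 0 < d) (hv : IsCyclicStationary a d v) (i : ZMod n) :
    v i ∈ Set.Icc (0 : ℝ) 1 := by
  obtain ⟨h0, h1⟩ := ha
  obtain ⟨j, hj⟩ := Finite.exists_min v
  obtain ⟨k, hk⟩ := Finite.exists_max v
  constructor
  · refine le_trans ?_ (hj i)
    by_contra! hneg
    have hL : 0 ≤ cyclicLaplacian v j := by
      unfold cyclicLaplacian; linarith [hj (j - 1), hj (j + 1)]
    have hg : 0 < g a (v j) :=
      mul_pos_of_neg_of_neg (mul_neg_of_neg_of_pos hneg (by linarith)) (by linarith)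
    linarith [hv j, mul_nonneg hd.le hL]
  · refine (hk i).trans ?_
    by_contra! hgt
    have hL : cyclicLaplacian v k ≤ 0 := by
      unfold cyclicLaplacian; linarith [hk (k - 1), hk (k + 1)]
    have hg : g a (v k) < 0 :=
      mul_neg_of_neg_of_pos (mul_neg_of_pos_of_neg (by linarith) (by linarith)) (by linarith)
    linarith [hv k, mul_nonpos_of_nonneg_of_nonpos hd.le hL]

/-- Every stationary solution is close to a function valued in the zeros of the nonlinearity. -/
theorem IsCyclicStationary.exists_roots_near {n : ℕ} [NeZero n] {a d ε : ℝ} {v : ZMod n → ℝ}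
    (ha : a ∈ Set.Ioo (0 : ℝ) 1) (hd : 0 < d) (hε : 0 ≤ ε) (hdε : 2 * d ≤ ε ^ 3)
    (hv : IsCyclicStationary a d v) :
    ∃ r : ZMod n → ℝ, (∀ i, r i ∈ ({0, a, 1} : Finset ℝ)) ∧ v ∈ Metric.closedBall r ε := by
  have hmem := hv.mem_Icc ha hd
  have hnear (i : ZMod n) : ∃ r ∈ ({0, a, 1} : Finset ℝ), |v i - r| ≤ ε := by
    refine exists_root_near hε (le_trans ?_ hdε)
    rw [show g a (v i) = -(d * cyclicLaplacian v i) by linarith [hv i], abs_neg, abs_mul,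
      abs_of_pos hd, mul_comm]
    gcongr
    rw [cyclicLaplacian, abs_le]
    constructor <;>
      linarith [(hmem i).1, (hmem i).2, (hmem (i - 1)).1, (hmem (i - 1)).2, (hmem (i + 1)).1,
        (hmem (i + 1)).2]
  choose r hr hvr using hnear
  exact ⟨r, hr, (dist_pi_le_iff hε).2 fun i ↦ by rw [Real.dist_eq]; exact hvr i⟩

/-- The simplified Newton map for the stationary equation, with the Jacobian frozen at `r` and
without coupling. -/
noncomputable def newtonMap {n : ℕ} (a d : ℝ) (r v : ZMod n → ℝ) (i : ZMod n) : ℝ :=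
  v i - (d * cyclicLaplacian v i + g a (v i)) / nagumoSlope a (r i)

/-- Near a function valued in the zeros of the nonlinearity there is exactly one stationary
solution. -/
theorem existsUnique_isCyclicStationary {n : ℕ} [NeZero n] {a d ε : ℝ} {r : ZMod n → ℝ}
    (ha : a ∈ Set.Ioo (0 : ℝ) 1) (hd : 0 < d) (hε : 0 < ε) (hεa : 52 * ε ≤ a * (1 - a))
    (hdε : 8 * d ≤ a * (1 - a) * ε) (hr : ∀ i, r i ∈ ({0, a, 1} : Finset ℝ)) :
    ∃! v, v ∈ Metric.closedBall r ε ∧ IsCyclicStationary a d v := by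
  set c := a * (1 - a) with hc
  have hc0 : 0 < c := by linarith
  have hc1 : c ≤ 1 := by nlinarith [ha.1, ha.2]
  have hslope (i : ZMod n) : c ≤ |nagumoSlope a (r i)| := le_abs_nagumoSlope ha (hr i)
  have hslope0 (i : ZMod n) : nagumoSlope a (r i) ≠ 0 :=
    abs_pos.1 (hc0.trans_le (hslope i))
  have hfix (v : ZMod n → ℝ) : newtonMap a d r v = v ↔ IsCyclicStationary a d v := by
    rw [funext_iff]
    refine forall_congr' fun i ↦ ?_
    simp [newtonMap, hslope0 i]
  have hlip {u v : ZMod n → ℝ} (hu : u ∈ Metric.closedBall r ε)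
      (hv : v ∈ Metric.closedBall r ε) :
      dist (newtonMap a d r u) (newtonMap a d r v) ≤ 1 / 2 * dist u v := by
    have hD : 0 ≤ dist u v := dist_nonneg
    refine (dist_pi_le_iff (by positivity)).2 fun i ↦ ?_
    have hui : |u i - r i| ≤ ε := (dist_le_pi_dist u r i).trans hu
    have hvi : |v i - r i| ≤ ε := (dist_le_pi_dist v r i).trans hv
    have huv : |u i - v i| ≤ dist u v := dist_le_pi_dist u v i
    have hg := abs_g_sub_slope_mul_le ha (mem_Icc_of_mem_roots ha (hr i)) (by linarith) hui hvi
    have hL := abs_cyclicLaplacian_sub_le u v i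
    have key : newtonMap a d r u i - newtonMap a d r v i =
        -(d * (cyclicLaplacian u i - cyclicLaplacian v i) +
          (g a (u i) - g a (v i) - nagumoSlope a (r i) * (u i - v i))) /
            nagumoSlope a (r i) := by
      have := hslope0 i
      simp only [newtonMap]
      field_simp
      ring
    rw [Real.dist_eq, key, abs_div, abs_neg, div_le_iff₀ (hc0.trans_le (hslope i))]
    calc _ ≤ |d * (cyclicLaplacian u i - cyclicLaplacian v i)| + _ := abs_add_le _ _
      _ ≤ d * (4 * dist u v) + 13 * ε * dist u v := by
        rw [abs_mul, abs_of_pos hd]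
        gcongr
        exact hg.trans (by gcongr)
      _ = (4 * d + 13 * ε) * dist u v := by ring
      _ ≤ (1 / 2 * c) * dist u v := by
        gcongr
        nlinarith
      _ ≤ (1 / 2 * |nagumoSlope a (r i)|) * dist u v := by
        gcongr
        exact hslope i
      _ = _ := by ring
  have hcenter : dist (newtonMap a d r r) r ≤ ε / 2 := by
    refine (dist_pi_le_iff (by positivity)).2 fun i ↦ ?_
    have hL : |cyclicLaplacian r i| ≤ 4 := by
      have hI (j : ZMod n) := mem_Icc_of_mem_roots ha (hr j)
      rw [cyclicLaplacian, abs_le]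
      constructor <;>
        linarith [(hI i).1, (hI i).2, (hI (i - 1)).1, (hI (i - 1)).2, (hI (i + 1)).1,
          (hI (i + 1)).2]
    have key : newtonMap a d r r i - r i =
        -(d * cyclicLaplacian r i) / nagumoSlope a (r i) := by
      rw [newtonMap, g_eq_zero_of_mem_roots (hr i)]; ring
    rw [Real.dist_eq, key, abs_div, abs_neg, div_le_iff₀ (hc0.trans_le (hslope i)), abs_mul,
      abs_of_pos hd]
    calc d * |cyclicLaplacian r i| ≤ d * 4 := by gcongr
      _ ≤ ε / 2 * c := by linarith
      _ ≤ _ := by gcongr; exact hslope i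
  have hmaps : Set.MapsTo (newtonMap a d r) (Metric.closedBall r ε) (Metric.closedBall r ε) := by
    intro u hu
    have h₁ := hlip hu (Metric.mem_closedBall_self hε.le)
    have h₂ : dist u r ≤ ε := hu
    have h₃ := dist_triangle (newtonMap a d r u) (newtonMap a d r r) r
    exact Metric.mem_closedBall.2 (by linarith)
  have hcontr : ContractingWith (1 / 2) (hmaps.restrict (newtonMap a d r) _ _) := by
    refine ⟨by rw [← NNReal.coe_lt_coe]; norm_num, LipschitzWith.of_dist_le_mul ?_⟩
    rintro ⟨u, hu⟩ ⟨v, hv⟩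
    simpa [Subtype.dist_eq] using hlip hu hv
  obtain ⟨v, hv, hvfix, -⟩ := hcontr.exists_fixedPoint' Metric.isClosed_closedBall.isComplete
    hmaps (Metric.mem_closedBall_self hε.le) (edist_ne_top _ _)
  refine ⟨v, ⟨hv, (hfix v).1 hvfix⟩, ?_⟩
  rintro w ⟨hw, hwsol⟩
  have h := hlip hw hv
  rw [(hfix w).2 hwsol, hvfix] at h
  exact dist_le_zero.1 (by linarith)

/-- For weak coupling there are exactly `3 ^ n` stationary solutions on `ZMod n`. -/
theorem ncard_setOf_isCyclicStationary {n : ℕ} [NeZero n] {a d ε : ℝ}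
    (ha : a ∈ Set.Ioo (0 : ℝ) 1) (hd : 0 < d) (hε : 0 < ε) (hεa : 52 * ε ≤ a * (1 - a))
    (hdε : 8 * d ≤ a * (1 - a) * ε) (hdε₃ : 2 * d ≤ ε ^ 3) :
    {v : ZMod n → ℝ | IsCyclicStationary a d v}.ncard = 3 ^ n := by
  classical
  have hex (r : ZMod n → ℝ) (hr : ∀ i, r i ∈ ({0, a, 1} : Finset ℝ)) :=
    existsUnique_isCyclicStationary ha hd hε hεa hdε hr
  choose! sol hsol huniq using hex
  let R : Finset (ZMod n → ℝ) := Fintype.piFinset fun _ ↦ {0, a, 1}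
  have hR {r : ZMod n → ℝ} : r ∈ R ↔ ∀ i, r i ∈ ({0, a, 1} : Finset ℝ) := Fintype.mem_piFinset
  have himage : {v : ZMod n → ℝ | IsCyclicStationary a d v} = sol '' (R : Set (ZMod n → ℝ)) := by
    ext v
    constructor
    · intro hv
      obtain ⟨r, hr, hvr⟩ := IsCyclicStationary.exists_roots_near ha hd hε.le hdε₃ hv
      exact ⟨r, hR.2 hr, (huniq r hr v ⟨hvr, hv⟩).symm⟩
    · rintro ⟨r, hr, rfl⟩
      exact (hsol r (hR.1 hr)).2
  have hinj : Set.InjOn sol (R : Set (ZMod n → ℝ)) := by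
    intro r hr s hs hrs
    have hr' := hR.1 hr
    have hs' := hR.1 hs
    have h₁ := Metric.mem_closedBall'.1 (hsol r hr').1
    have h₂ := Metric.mem_closedBall.1 (hsol s hs').1
    rw [hrs] at h₁
    funext i
    refine eq_of_abs_sub_lt_of_mem_roots ha (hr' i) (hs' i) ?_
    calc |r i - s i| ≤ dist r s := dist_le_pi_dist r s i
      _ ≤ dist r (sol s) + dist (sol s) s := dist_triangle _ _ _
      _ < a * (1 - a) := by linarith
  have hcard : ({0, a, 1} : Finset ℝ).card = 3 :=
    Finset.card_eq_three.2 ⟨0, a, 1, ha.1.ne, zero_ne_one, ha.2.ne, rfl⟩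
  rw [himage, hinj.ncard_image, Set.ncard_coe_finset, Fintype.card_piFinset]
  simp [hcard, ZMod.card]

/-- Periodic stationary sequences on `ℤ` are the pullbacks of stationary functions on `ZMod n`. -/
theorem setOf_periodic_stationary_eq_image (n : ℕ) [NeZero n] (a d : ℝ) :
    {u : ℤ → ℝ | (∀ i : ℤ, u (i + n) = u i) ∧
        ∀ i : ℤ, d * (u (i - 1) - 2 * u i + u (i + 1)) + g a (u i) = 0} =
      (fun (v : ZMod n → ℝ) (i : ℤ) ↦ v i) '' {v | IsCyclicStationary a d v} := by
  ext u
  constructor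
  · rintro ⟨hper, hu⟩
    have hlift (i : ℤ) : u ((i : ZMod n).val : ℤ) = u i := by
      rw [ZMod.val_intCast, Int.emod_def, mul_comm]
      exact Function.Periodic.sub_int_mul_eq (f := u) hper (i / n)
    refine ⟨fun z ↦ u (z.val : ℤ), fun z ↦ ?_, funext hlift⟩
    obtain ⟨i, rfl⟩ := ZMod.intCast_surjective z
    have h₁ := hlift (i - 1)
    have h₂ := hlift (i + 1)
    push_cast at h₁ h₂
    simp only [cyclicLaplacian]
    rw [h₁, h₂, hlift]
    exact hu i
  · rintro ⟨v, hv, rfl⟩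
    refine ⟨fun i ↦ by simp, fun i ↦ ?_⟩
    simpa [cyclicLaplacian] using hv i

/-- For fixed `n ≥ 3` and `a ∈ (0,1)`, there is `d₀ > 0` such that for every
`d ∈ (0, d₀)` the lattice Nagumo equation has exactly `3ⁿ` `n`-periodic
stationary solutions. -/
theorem card_periodic_stationary_solutions
    (n : ℕ) (hn : 3 ≤ n) (a : ℝ) (ha : a ∈ Set.Ioo (0:ℝ) 1) :
    ∃ d0 > (0:ℝ), ∀ d ∈ Set.Ioo (0:ℝ) d0,
      {u : ℤ → ℝ | (∀ i : ℤ, u (i + n) = u i) ∧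
        ∀ i : ℤ, d * (u (i - 1) - 2 * u i + u (i + 1)) + g a (u i) = 0}.ncard = 3 ^ n := by
  have : NeZero n := ⟨by omega⟩
  have hc : 0 < a * (1 - a) := mul_pos ha.1 (sub_pos.2 ha.2)
  have hc1 : a * (1 - a) ≤ 1 := by nlinarith [ha.1, ha.2]
  obtain ⟨ε, hε, hεa⟩ : ∃ ε > 0, 52 * ε = a * (1 - a) :=
    ⟨a * (1 - a) / 52, by positivity, by ring⟩
  refine ⟨ε ^ 3 / 8, by positivity, fun d hd ↦ ?_⟩
  have hd8 : 8 * d ≤ ε ^ 3 := by linarith [hd.2]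
  have hinj : Function.Injective fun (v : ZMod n → ℝ) (i : ℤ) ↦ v i :=
    (ZMod.intCast_surjective (n := n)).injective_comp_right
  rw [setOf_periodic_stationary_eq_image, Set.ncard_image_of_injective _ hinj]
  refine ncard_setOf_isCyclicStationary ha hd.1 hε hεa.le ?_ (by linarith [hd.1])
  calc 8 * d ≤ ε ^ 3 := hd8
    _ = ε * ε * ε := by ring
    _ ≤ a * (1 - a) * ε := mul_le_mul_of_nonneg_right (by nlinarith) hε.le
end

section
/- Fix $n \ge 3$ and $a \in (0,1)$, and let $\mathrm{w} \in \{0,1\}^n$ (a vector whose entries are all $0$ or $1$). Then there exist $d_0 > 0$ and $\varepsilon > 0$ such that for every $d \in (0, d_0)$ there is a unique solution $\mathrm{u}_\mathrm{w}(d)$ of the cyclic system $d(\mathrm{u}_{i-1} - 2\mathrm{u}_i + \mathrm{u}_{i+1}) + g(\mathrm{u}_i;a) = 0$ (indices mod $n$) in the $\varepsilon$-ball around $\mathrm{w}$, and the Jacobian matrix $D_1 G(\mathrm{u}_\mathrm{w}(d); a, d)$ has all eigenvalues with negative real part (i.e., is Hurwitz), so that $\mathrm{u}_\mathrm{w}(d)$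 is an asymptotically stable equilibrium of the ODE $\dot{\mathrm{u}} = G(\mathrm{u};a,d)$ on $\mathbb{R}^n$. -/
open Filter

/-- The derivative `g'(u; a)` of the cubic nonlinearity with respect to `u`. -/
noncomputable def gder (a u : ℝ) : ℝ := (1 - u) * (u - a) - u * (u - a) + u * (1 - u)

/-- The Jacobian matrix `D₁G(v; a, d)` of the cyclic Nagumo system with respect to `v`. -/
noncomputable def Jac (n : ℕ) (a d : ℝ) (v : ZMod n → ℝ) : Matrix (ZMod n) (ZMod n) ℝ :=
  fun i j => (if j = i - 1 then d else 0) + (if j = i + 1 then d else 0) +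
    (if j = i then -(2 * d) + gder a (v i) else 0)

open Metric in
/-- A vector field whose Euler step of some positive length contracts a closed ball at rate `m`
has a zero in that ball as soon as it is small enough at the centre. -/
theorem exists_zero_of_euler_contracting {E : Type*} [NormedAddCommGroup E] [NormedSpace ℝ E]
    [CompleteSpace E] {F : E → E} {w : E} {ε m h : ℝ} (hε : 0 ≤ ε) (hm : 0 < m) (hh : 0 < h)
    (hmh : h * m ≤ 1)
    (hF : ∀ u ∈ closedBall w ε, ∀ v ∈ closedBall w ε,
      ‖(u + h • F u) - (v + h • F v)‖ ≤ (1 - h * m) * ‖u - v‖)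
    (hw : ‖F w‖ ≤ m * ε) : ∃ p ∈ closedBall w ε, F p = 0 := by
  have hww : w ∈ closedBall w ε := mem_closedBall_self hε
  have hmaps : Set.MapsTo (fun u => u + h • F u) (closedBall w ε) (closedBall w ε) := by
    intro u hu
    have hstep := hF u hu w hww
    have hu' : ‖u - w‖ ≤ ε := by simpa [dist_eq_norm] using hu
    have hsplit : u + h • F u - w = (u + h • F u - (w + h • F w)) + h • F w := by abel
    rw [mem_closedBall, dist_eq_norm, hsplit]
    refine (norm_add_le _ _).trans ?_
    rw [norm_smul, Real.norm_of_nonneg hh.le]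
    nlinarith [mul_le_mul_of_nonneg_left hu' (sub_nonneg.2 hmh),
      mul_le_mul_of_nonneg_left hw hh.le]
  have hcontr : ContractingWith (1 - h * m).toNNReal (hmaps.restrict _ _ _) := by
    refine ⟨?_, LipschitzWith.of_dist_le_mul fun u v => ?_⟩
    · rw [Real.toNNReal_lt_one]
      nlinarith [mul_pos hh hm]
    · rw [Real.coe_toNNReal _ (sub_nonneg.2 hmh), Subtype.dist_eq, Subtype.dist_eq, dist_eq_norm,
        dist_eq_norm]
      exact hF u u.2 v v.2
  obtain ⟨p, hp, hfix, -⟩ := hcontr.exists_fixedPoint' isClosed_closedBall.isComplete hmaps hww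
    (edist_ne_top _ _)
  refine ⟨p, hp, ?_⟩
  have hzero : h • F p = 0 := by simpa [Function.IsFixedPt] using hfix
  exact (smul_eq_zero.1 hzero).resolve_left hh.ne'

open Metric Set Topology in
/-- If the short Euler steps of a vector field contract a closed ball towards its centre at
rate `m`, then trajectories starting in the ball decay exponentially to the centre. -/
theorem norm_sub_le_exp_of_euler_contracting {E : Type*} [NormedAddCommGroup E] [NormedSpace ℝ E]
    {F : E → E} {p : E} {r m h₀ δ : ℝ} (hm : 0 < m) (hh₀ : 0 < h₀) (hδ : 0 < δ) (hδr : δ ≤ r)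
    (hF : ∀ h ∈ Icc 0 h₀, ∀ u ∈ closedBall p r, ‖u + h • F u - p‖ ≤ (1 - h * m) * ‖u - p‖)
    {V : ℝ → E} (hV : ∀ t : ℝ, 0 ≤ t → HasDerivAt V (F (V t)) t) (hV0 : ‖V 0 - p‖ ≤ δ)
    {t : ℝ} (ht : 0 ≤ t) : ‖V t - p‖ ≤ δ * Real.exp (-(m / 2) * t) := by
  have hV' : ∀ x, 0 ≤ x → HasDerivAt (fun s => V s - p) (F (V x)) x :=
    fun x hx => (hV x hx).sub_const p
  refine image_le_of_liminf_slope_right_lt_deriv_boundary (f := fun s => ‖V s - p‖)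
    (f' := fun s => if ‖V s - p‖ ≤ r then -m * ‖V s - p‖ else ‖F (V s)‖)
    (B := fun s => δ * Real.exp (-(m / 2) * s))
    (B' := fun s => δ * (Real.exp (-(m / 2) * s) * (-(m / 2)))) (a := 0) (b := t)
    (fun x hx => (hV' x hx.1).continuousAt.norm.continuousWithinAt) ?_ (by simpa using hV0)
    (fun x => ?_) ?_ (right_mem_Icc.2 ht)
  · intro x hx q hq
    split_ifs at hq with hxr
    · refine Eventually.frequently ?_
      have hc : 0 < (q + m * ‖V x - p‖) / 2 := by linarith
      have hsmall := ((hV x hx.1).isLittleO.def hc).filter_mono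
        (nhdsWithin_le_nhds (s := Ioi x))
      filter_upwards [hsmall, Ioc_mem_nhdsGT (show x < x + h₀ by linarith)] with z hz hzx
      have hpos : 0 < z - x := sub_pos.2 hzx.1
      have hstep := hF (z - x) ⟨hpos.le, by linarith [hzx.2]⟩ (V x)
        (by simpa [dist_eq_norm] using hxr)
      rw [Real.norm_of_nonneg hpos.le] at hz
      have hsplit : V z - p =
          (V x + (z - x) • F (V x) - p) + (V z - V x - (z - x) • F (V x)) := by abel
      have htri : ‖V z - p‖ ≤
          ‖V x + (z - x) • F (V x) - p‖ + ‖V z - V x - (z - x) • F (V x)‖ := by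
        rw [hsplit]
        exact norm_add_le _ _
      rw [slope_def_field, div_lt_iff₀ hpos]
      nlinarith [mul_pos hpos hc]
    · have := (hV' x hx.1).hasDerivWithinAt.liminf_right_slope_norm_le hq
      simpa [slope_def_module] using this
  · have := (((hasDerivAt_id x).const_mul (-(m / 2))).exp).const_mul δ
    simpa using this
  · intro x hx hxB
    have hB : 0 < δ * Real.exp (-(m / 2) * x) := by positivity
    have hle : Real.exp (-(m / 2) * x) ≤ 1 := Real.exp_le_one_iff.2 (by nlinarith [hx.1])
    have hxr : ‖V x - p‖ ≤ r := by
      rw [hxB]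
      nlinarith
    rw [if_pos hxr, hxB]
    nlinarith

/-- The slope of the chord of `g` between `u` and `v`. -/
noncomputable def chordSlope (a u v : ℝ) : ℝ :=
  -(u ^ 2 + u * v + v ^ 2) + (1 + a) * (u + v) - a

theorem g_sub_g (a u v : ℝ) : g a u - g a v = chordSlope a u v * (u - v) := by
  unfold g chordSlope
  ring

theorem chordSlope_self (a u : ℝ) : chordSlope a u u = gder a u := by
  unfold gder chordSlope
  ring

theorem chordSlope_le {a c e u v : ℝ} (ha : a ∈ Set.Ioo (0 : ℝ) 1) (hca : c ≤ a)
    (hca' : c ≤ 1 - a) (he : e = 0 ∨ e = 1) (hu : |u - e| ≤ c / 8) (hv : |v - e| ≤ c / 8) :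
    chordSlope a u v ≤ -(c / 2) := by
  obtain ⟨ha0, ha1⟩ := ha
  obtain ⟨hu1, hu2⟩ := abs_le.1 hu
  obtain ⟨hv1, hv2⟩ := abs_le.1 hv
  unfold chordSlope
  rcases he with rfl | rfl
  · nlinarith [sq_nonneg (u + v), sq_nonneg u, sq_nonneg v,
      mul_nonneg ha0.le (show 0 ≤ c / 4 - (u + v) by linarith)]
  · nlinarith [sq_nonneg ((u - 1) + (v - 1)), sq_nonneg (u - 1), sq_nonneg (v - 1),
      mul_nonneg (show 0 ≤ 2 - a by linarith) (show 0 ≤ c / 4 + ((u - 1) + (v - 1)) by linarith)]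

theorem neg_le_chordSlope {a u v : ℝ} (ha : a ∈ Set.Ioo (0 : ℝ) 1) (hu : |u| ≤ 2)
    (hv : |v| ≤ 2) : -21 ≤ chordSlope a u v := by
  obtain ⟨ha0, ha1⟩ := ha
  obtain ⟨hu1, hu2⟩ := abs_le.1 hu
  obtain ⟨hv1, hv2⟩ := abs_le.1 hv
  unfold chordSlope
  nlinarith [mul_nonneg (show 0 ≤ 1 + a by linarith) (show 0 ≤ 4 + (u + v) by linarith),
    sq_nonneg (u - v), mul_nonneg (sub_nonneg.2 hu2) (show 0 ≤ u + 2 by linarith),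
    mul_nonneg (sub_nonneg.2 hv2) (show 0 ≤ v + 2 by linarith)]

open Metric Set in
/-- Near a binary word, short Euler steps of the cyclic Nagumo system contract in the
supremum norm. -/
theorem GF_euler_contracting {n : ℕ} [NeZero n] {a c d h : ℝ} (ha : a ∈ Ioo (0 : ℝ) 1)
    (hca : c ≤ a) (hca' : c ≤ 1 - a) {w : ZMod n → ℝ} (hw : ∀ i, w i = 0 ∨ w i = 1)
    (hd : d ∈ Ioo (0 : ℝ) 1) (hh : h ∈ Icc (0 : ℝ) (1 / 23)) {u v : ZMod n → ℝ}
    (hu : u ∈ closedBall w (c / 8)) (hv : v ∈ closedBall w (c / 8)) :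
    ‖(u + h • GF n a d u) - (v + h • GF n a d v)‖ ≤ (1 - h * (c / 2)) * ‖u - v‖ := by
  obtain ⟨hd0, hd1⟩ := hd
  obtain ⟨hh0, hh1⟩ := hh
  have hc2 : c ≤ 1 / 2 := by linarith
  have hcoord : ∀ i, |u i - v i| ≤ ‖u - v‖ := fun i => by
    simpa using norm_le_pi_norm (u - v) i
  have hnear : ∀ z ∈ closedBall w (c / 8), ∀ i, |z i - w i| ≤ c / 8 := fun z hz i => by
    simpa [Real.dist_eq] using (dist_le_pi_dist z w i).trans hz
  have habs : ∀ z ∈ closedBall w (c / 8), ∀ i, |z i| ≤ 2 := fun z hz i => by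
    obtain ⟨h1, h2⟩ := abs_le.1 (hnear z hz i)
    rcases hw i with hi | hi <;> rw [hi] at h1 h2 <;> exact abs_le.2 ⟨by linarith, by linarith⟩
  refine (pi_norm_le_iff_of_nonneg (mul_nonneg (by nlinarith) (norm_nonneg _))).2 fun i => ?_
  have hq1 := chordSlope_le ha hca hca' (hw i) (hnear u hu i) (hnear v hv i)
  have hq2 := neg_le_chordSlope ha (habs u hu i) (habs v hv i)
  have hg := g_sub_g a (u i) (v i)
  set q := chordSlope a (u i) (v i)
  have hcoef : 0 ≤ 1 - 2 * (h * d) + h * q := by nlinarith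
  have hhd : 0 ≤ h * d := by positivity
  have hexpand : (u + h • GF n a d u - (v + h • GF n a d v)) i =
      (1 - 2 * (h * d) + h * q) * (u i - v i) + (h * d) * (u (i - 1) - v (i - 1)) +
        (h * d) * (u (i + 1) - v (i + 1)) := by
    simp only [Pi.sub_apply, Pi.add_apply, Pi.smul_apply, smul_eq_mul, GF]
    linear_combination h * hg
  rw [hexpand, Real.norm_eq_abs]
  refine (abs_add_three _ _ _).trans ?_
  rw [abs_mul, abs_mul (h * d), abs_mul (h * d), abs_of_nonneg hcoef, abs_of_nonneg hhd]
  calc _ ≤ (1 - 2 * (h * d) + h * q) * ‖u - v‖ + (h * d) * ‖u - v‖ + (h * d) * ‖u - v‖ := by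
        gcongr <;> exact hcoord _
    _ = (1 + h * q) * ‖u - v‖ := by ring
    _ ≤ (1 - h * (c / 2)) * ‖u - v‖ := by
        gcongr
        nlinarith

theorem norm_GF_binary_le {n : ℕ} [NeZero n] {a d : ℝ} (hd : 0 ≤ d) {w : ZMod n → ℝ}
    (hw : ∀ i, w i = 0 ∨ w i = 1) : ‖GF n a d w‖ ≤ 2 * d := by
  refine (pi_norm_le_iff_of_nonneg (by positivity)).2 fun i => ?_
  have hgi : g a (w i) = 0 := by rcases hw i with hi | hi <;> simp [g, hi]
  rw [Real.norm_eq_abs, GF, hgi, abs_le]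
  rcases hw i with h1 | h1 <;> rcases hw (i - 1) with h2 | h2 <;>
    rcases hw (i + 1) with h3 | h3 <;> rw [h1, h2, h3] <;> constructor <;> linarith

/-- The Jacobian is Hurwitz wherever `g'` is negative at every entry. -/
theorem Jac_spectrum_re_neg {n : ℕ} [NeZero n] (hn : 3 ≤ n) {a d : ℝ} (hd : 0 ≤ d)
    {v : ZMod n → ℝ} (hv : ∀ i, gder a (v i) < 0) {μ : ℂ}
    (hμ : μ ∈ spectrum ℂ ((Jac n a d v).map (Complex.ofReal ·))) : μ.re < 0 := by
  have : Fact (1 < n) := ⟨by omega⟩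
  rw [← Matrix.spectrum_toLin', ← Module.End.hasEigenvalue_iff_mem_spectrum] at hμ
  obtain ⟨k, hk⟩ := eigenvalue_mem_ball hμ
  have hdiag : Jac n a d v k k = -(2 * d) + gder a (v k) := by
    simp [Jac, eq_comm (a := k) (b := k - 1)]
  have hoff : ∑ j ∈ Finset.univ.erase k, ‖((Jac n a d v).map (Complex.ofReal ·)) k j‖ ≤ 2 * d := by
    calc _ ≤ ∑ j ∈ Finset.univ.erase k,
          ((if j = k - 1 then d else 0) + (if j = k + 1 then d else 0)) := by
          refine Finset.sum_le_sum fun j hj => ?_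
          have hjk : j ≠ k := Finset.ne_of_mem_erase hj
          simp only [Matrix.map_apply, Complex.norm_real, Jac, hjk, if_false, add_zero]
          exact (Real.norm_of_nonneg (by positivity)).le
      _ ≤ ∑ j, ((if j = k - 1 then d else 0) + (if j = k + 1 then d else 0)) :=
          Finset.sum_le_sum_of_subset_of_nonneg (Finset.erase_subset _ _)
            fun _ _ _ => by positivity
      _ = 2 * d := by
          rw [Finset.sum_add_distrib]
          simp
          ring
  rw [Metric.mem_closedBall, dist_eq_norm, Matrix.map_apply, hdiag] at hk
  have hre := (Complex.re_le_norm _).trans (hk.trans hoff)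
  rw [Complex.sub_re, Complex.ofReal_re] at hre
  linarith [hv k]

open Metric Set in
theorem ODEAsympStable_of_euler_contracting {n : ℕ} [NeZero n] {a d r m h₀ : ℝ}
    {p : ZMod n → ℝ} (hr : 0 < r) (hm : 0 < m) (hh₀ : 0 < h₀)
    (hF : ∀ h ∈ Icc 0 h₀, ∀ u ∈ closedBall p r,
      ‖u + h • GF n a d u - p‖ ≤ (1 - h * m) * ‖u - p‖) : ODEAsympStable n a d p := by
  constructor
  · intro ε hε
    refine ⟨min r (ε / 2), by positivity, fun V hV hV0 t ht => ?_⟩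
    have hdecay := norm_sub_le_exp_of_euler_contracting hm hh₀ (by positivity) (min_le_left _ _)
      hF hV hV0.le ht
    have hle : Real.exp (-(m / 2) * t) ≤ 1 := Real.exp_le_one_iff.2 (by nlinarith)
    have hmin : 0 < min r (ε / 2) := by positivity
    nlinarith [min_le_right r (ε / 2)]
  · refine ⟨r, hr, fun V hV hV0 => ?_⟩
    rw [tendsto_iff_norm_sub_tendsto_zero]
    have hexp : Tendsto (fun t => r * Real.exp (-(m / 2) * t)) atTop (nhds 0) := by
      have hlin : Tendsto (fun t : ℝ => -(m / 2) * t) atTop atBot :=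
        tendsto_id.const_mul_atTop_of_neg (by linarith)
      simpa using (Real.tendsto_exp_atBot.comp hlin).const_mul r
    refine squeeze_zero' (Eventually.of_forall fun _ => norm_nonneg _) ?_ hexp
    filter_upwards [eventually_ge_atTop 0] with t ht
    exact norm_sub_le_exp_of_euler_contracting hm hh₀ hr le_rfl hF hV hV0.le ht

/-- For every word `w ∈ {0,1}ⁿ` and all small `d > 0`, there is a unique stationary
solution of the cyclic Nagumo system near `w`; its Jacobian is Hurwitz and it is an
asymptotically stable equilibrium of the graph Nagumo ODE. -/
theorem stable_branch_of_binary_root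
    (n : ℕ) [NeZero n] (hn : 3 ≤ n) (a : ℝ) (ha : a ∈ Set.Ioo (0:ℝ) 1)
    (w : ZMod n → ℝ) (hw : ∀ i, w i = 0 ∨ w i = 1) :
    ∃ d0 > (0:ℝ), ∃ ε > (0:ℝ), ∀ d ∈ Set.Ioo (0:ℝ) d0,
      ∃ uw : ZMod n → ℝ,
        (uw ∈ Metric.ball w ε ∧ ∀ i : ZMod n, GF n a d uw i = 0) ∧
        (∀ z : ZMod n → ℝ,
          (z ∈ Metric.ball w ε ∧ ∀ i : ZMod n, GF n a d z i = 0) → z = uw) ∧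
        (∀ μ ∈ spectrum ℂ ((Jac n a d uw).map (Complex.ofReal ·)), μ.re < 0) ∧
        ODEAsympStable n a d uw := by
  obtain ⟨c, hc, hca, hca'⟩ : ∃ c > 0, c ≤ a ∧ c ≤ 1 - a :=
    ⟨min a (1 - a), lt_min ha.1 (sub_pos.2 ha.2), min_le_left _ _, min_le_right _ _⟩
  have hc2 : c ≤ 1 / 2 := by linarith
  refine ⟨c ^ 2 / 64, by positivity, c / 8, by positivity, fun d hd => ?_⟩
  have hd1 : d ∈ Set.Ioo (0 : ℝ) 1 := ⟨hd.1, hd.2.trans (by nlinarith)⟩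
  have hcontr : ∀ h ∈ Set.Icc (0 : ℝ) (1 / 23), ∀ u ∈ Metric.closedBall w (c / 8),
      ∀ v ∈ Metric.closedBall w (c / 8),
      ‖(u + h • GF n a d u) - (v + h • GF n a d v)‖ ≤ (1 - h * (c / 2)) * ‖u - v‖ :=
    fun h hh u hu v hv => GF_euler_contracting ha hca hca' hw hd1 hh hu hv
  have hGw : ‖GF n a d w‖ ≤ c / 2 * (c / 16) :=
    (norm_GF_binary_le hd.1.le hw).trans (by nlinarith [hd.2])
  have hsub : Metric.closedBall w (c / 16) ⊆ Metric.closedBall w (c / 8) :=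
    Metric.closedBall_subset_closedBall (by linarith)
  obtain ⟨p, hp, hGp⟩ := exists_zero_of_euler_contracting (F := GF n a d) (h := 1 / 23)
    (by positivity) (half_pos hc) (by norm_num) (by linarith)
    (fun u hu v hv => hcontr _ (by norm_num) u (hsub hu) v (hsub hv)) hGw
  refine ⟨p, ⟨Metric.closedBall_subset_ball (by linarith) hp, congrFun hGp⟩, ?_, ?_, ?_⟩
  · rintro z ⟨hz, hGz⟩
    have hstep := hcontr (1 / 23) (by norm_num) z (Metric.ball_subset_closedBall hz) p (hsub hp)
    rw [show GF n a d z = 0 from funext hGz, hGp, smul_zero, add_zero, add_zero] at hstep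
    exact sub_eq_zero.1 (norm_le_zero_iff.1 (by nlinarith))
  · intro μ hμ
    refine Jac_spectrum_re_neg hn hd.1.le (fun i => ?_) hμ
    have hpi : |p i - w i| ≤ c / 8 := by
      simpa [Real.dist_eq] using (dist_le_pi_dist p w i).trans (hsub hp)
    have := chordSlope_le ha hca hca' (hw i) hpi hpi
    rw [chordSlope_self] at this
    linarith
  · refine ODEAsympStable_of_euler_contracting (r := c / 16) (m := c / 2) (h₀ := 1 / 23)
      (by positivity) (by positivity) (by norm_num) fun h hh u hu => ?_
    have huw : u ∈ Metric.closedBall w (c / 8) :=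
      Metric.closedBall_subset_closedBall' (by linarith [Metric.mem_closedBall.1 hp]) hu
    simpa [hGp] using hcontr h hh u huw p (hsub hp)
end

section
/- Let $n \ge 1$ and $k \ge 1$. The number of orbits of the dihedral group action (cyclic shifts and reflection) on $\{1,\ldots,k\}^n$ that consist of aperiodic words (i.e., the number of primitive $k$-ary bracelets, or Lyndon bracelets, of length $n$) equals $BL_k(n) = \sum_{d \mid n} \mu(d)\, B_k(n/d)$, where $B_k$ is the bracelet-counting function; equivalently, $B_k(n) = \sum_{d \mid n} BL_k(d)$. -/
/-- The generating relation of the dihedral action on words `w : ZMod n → Fin k`: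
`w'` is either the cyclic shift `(T₁ w)_i = w_{i+1}` or the reflection
`(R w)_i = w_{1-i}` of `w`. The quotient `Quot (DihRel n k)` identifies words in the
same orbit of the dihedral group, so its elements are exactly the `k`-ary bracelets
of length `n`. -/
def DihRel (n k : ℕ) (w w' : ZMod n → Fin k) : Prop :=
  (∀ i : ZMod n, w' i = w (i + 1)) ∨ (∀ i : ZMod n, w' i = w (1 - i))

/-- A word `w : ZMod n → Fin k` is aperiodic (primitive) if no nontrivial cyclic shift
fixes it. -/
def AperiodicWord (n k : ℕ) (w : ZMod n → Fin k) : Prop :=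
  ∀ ℓ : ZMod n, (∀ i : ZMod n, w (i + ℓ) = w i) → ℓ = 0

/-- The number of primitive `k`-ary bracelets (Lyndon bracelets) of length `n`: the
number of dihedral orbits consisting of aperiodic words. -/
noncomputable def lyndonBraceletCount (n k : ℕ) : ℕ :=
  {o : Quot (DihRel n k) |
    ∀ w : ZMod n → Fin k, Quot.mk (DihRel n k) w = o → AperiodicWord n k w}.ncard

/-- `N_k(n) = (1/n) ∑_{d∣n} φ(d) k^{n/d}`, the necklace-counting function. -/
def Nq (k n : ℕ) : ℚ :=
  (1 / n) * ∑ d ∈ n.divisors, (Nat.totient d : ℚ) * (k : ℚ) ^ (n / d)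

/-- `B_k(n)`, the bracelet-counting function. -/
def Bq (k n : ℕ) : ℚ :=
  if Even n then (1 / 2) * (Nq k n + ((k : ℚ) + 1) / 2 * (k : ℚ) ^ (n / 2))
  else (1 / 2) * (Nq k n + (k : ℚ) ^ ((n + 1) / 2))

open Finset

namespace Bracelet

/-- The dihedral group acts on words by cyclic shifts `w ↦ w (· + a)` and reflections
`w ↦ w (a - ·)`. -/
instance wordAction (n k : ℕ) : MulAction (DihedralGroup n) (ZMod n → Fin k) where
  smul
    | .r a, w => fun i => w (i + a)
    | .sr a, w => fun i => w (a - i)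
  one_smul w := funext fun i => congrArg w (add_zero i)
  mul_smul g h w := by
    rcases g with a | a <;> rcases h with b | b <;> funext i <;>
      refine congrArg w ?_ <;> ring

variable {n k : ℕ}

theorem r_smul_apply (a : ZMod n) (w : ZMod n → Fin k) (i : ZMod n) :
    (DihedralGroup.r a • w) i = w (i + a) := rfl

theorem sr_smul_apply (a : ZMod n) (w : ZMod n → Fin k) (i : ZMod n) :
    (DihedralGroup.sr a • w) i = w (a - i) := rfl

theorem mk_r_smul [NeZero n] (a : ZMod n) (w : ZMod n → Fin k) :
    Quot.mk (DihRel n k) (DihedralGroup.r a • w) = Quot.mk (DihRel n k) w := by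
  rw [← ZMod.natCast_zmod_val a]
  induction a.val with
  | zero => simp [DihedralGroup.r_zero]
  | succ m ih =>
    rw [← ih]
    refine (Quot.sound (r := DihRel n k) (Or.inl fun i => ?_)).symm
    simp only [r_smul_apply]
    congr 1
    push_cast
    ring

theorem mk_eq_mk_iff [NeZero n] {w w' : ZMod n → Fin k} :
    Quot.mk (DihRel n k) w = Quot.mk (DihRel n k) w' ↔
      MulAction.orbitRel (DihedralGroup n) (ZMod n → Fin k) w w' := by
  constructor
  · intro h
    have hrel : ∀ u v : ZMod n → Fin k, DihRel n k u v →
        (Quotient.mk (MulAction.orbitRel (DihedralGroup n) (ZMod n → Fin k)) u) =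
          Quotient.mk _ v := by
      rintro u v (h | h)
      · exact .symm <| Quotient.sound <| MulAction.orbitRel_apply.mpr
          ⟨.r 1, funext fun i => (h i).symm⟩
      · exact .symm <| Quotient.sound <| MulAction.orbitRel_apply.mpr
          ⟨.sr 1, funext fun i => (h i).symm⟩
    exact Quotient.exact (congrArg (Quot.lift _ hrel) h)
  · rintro ⟨a | a, rfl⟩
    · exact mk_r_smul a w'
    · have : DihedralGroup.sr a • w' =
          DihedralGroup.r (1 - a) • (DihedralGroup.sr (1 : ZMod n) • w') := by
        rw [← mul_smul, DihedralGroup.r_mul_sr, sub_sub_cancel]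
      change Quot.mk _ (DihedralGroup.sr a • w') = _
      rw [this, mk_r_smul]
      exact (Quot.sound (r := DihRel n k) (Or.inr fun i => rfl)).symm

/-- Bracelets are the orbits of the dihedral group on words. -/
def quotEquivOrbits (n k : ℕ) [NeZero n] :
    Quot (DihRel n k) ≃ Quotient (MulAction.orbitRel (DihedralGroup n) (ZMod n → Fin k)) where
  toFun := Quot.lift (Quotient.mk _) fun _ _ h =>
    Quotient.sound (mk_eq_mk_iff.mp (Quot.sound h))
  invFun := Quotient.lift (Quot.mk _) fun _ _ h => mk_eq_mk_iff.mpr h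
  left_inv := by rintro ⟨w⟩; rfl
  right_inv := by rintro ⟨w⟩; rfl

/-! ### Fixed words of rotations and reflections -/

/-- Words fixed by the shift by `a` are functions on the cosets of the subgroup spanned by `a`. -/
def shiftFixedEquiv (a : ZMod n) :
    {w : ZMod n → Fin k // ∀ i, w (i + a) = w i} ≃
      (ZMod n ⧸ AddSubgroup.zmultiples a → Fin k) where
  toFun w := fun q => Quotient.liftOn' q w.1 fun x y hxy => by
    rw [QuotientAddGroup.leftRel_apply] at hxy
    obtain ⟨m, hm⟩ := hxy
    have hper : Function.Periodic w.1 a := w.2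
    have hy : y = x + m • a := by
      have : m • a = -x + y := hm
      rw [this]; abel
    rw [hy, (hper.zsmul m) x]
  invFun v := ⟨fun i => v (i : ZMod n ⧸ AddSubgroup.zmultiples a), fun i => by
    refine congrArg v (QuotientAddGroup.eq.mpr ?_)
    simp⟩
  left_inv w := rfl
  right_inv v := by
    funext q
    induction q using QuotientAddGroup.induction_on
    rfl

theorem card_shiftFixed [NeZero n] (a : ZMod n) :
    Nat.card {w : ZMod n → Fin k // ∀ i, w (i + a) = w i} = k ^ (n / addOrderOf a) := by
  rw [Nat.card_congr (shiftFixedEquiv a), Nat.card_fun, Nat.card_fin,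
    ← AddSubgroup.index_eq_card]
  congr 1
  have h := AddSubgroup.card_mul_index (AddSubgroup.zmultiples a)
  rw [Nat.card_zmultiples, Nat.card_zmod] at h
  exact (Nat.div_eq_of_eq_mul_right (addOrderOf_pos a) h.symm).symm

theorem sum_card_shiftFixed [NeZero n] :
    ∑ a : ZMod n, Nat.card {w : ZMod n → Fin k // ∀ i, w (i + a) = w i} =
      ∑ d ∈ n.divisors, d.totient * k ^ (n / d) := by
  simp only [card_shiftFixed]
  have hmaps : ∀ a ∈ (univ : Finset (ZMod n)), addOrderOf a ∈ n.divisors := fun a _ => by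
    rw [Nat.mem_divisors]
    exact ⟨by simpa using addOrderOf_dvd_card (x := a), NeZero.ne n⟩
  rw [← sum_fiberwise_of_maps_to hmaps]
  refine sum_congr rfl fun d hd => ?_
  rw [sum_congr rfl (g := fun _ => k ^ (n / d))
    (fun a ha => by rw [(mem_filter.mp ha).2]), sum_const, smul_eq_mul]
  congr 1
  exact IsAddCyclic.card_addOrderOf_eq_totient (by simpa using Nat.dvd_of_mem_divisors hd)

/-- Words fixed by an involution `σ` are determined by their values on the points `i` with
`f i ≤ f (σ i)`, where `f` is any injective labelling. -/
def involutionFixedEquiv {α β : Type*} {f : α → ℕ} (hf : Function.Injective f) {σ : α → α}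
    (hσ : Function.Involutive σ) :
    {w : α → β // ∀ i, w (σ i) = w i} ≃ ({i // f i ≤ f (σ i)} → β) where
  toFun w i := w.1 i
  invFun v := ⟨fun i => if h : f i ≤ f (σ i) then v ⟨i, h⟩ else
      v ⟨σ i, by rw [hσ i]; exact (lt_of_not_ge h).le⟩, fun i => by
    rcases lt_trichotomy (f i) (f (σ i)) with h | h | h
    · simp [hσ i, h.le, h.not_ge]
    · simp only [← hf h]
    · simp [hσ i, h.le, h.not_ge]⟩
  left_inv w := by
    ext i
    by_cases h : f i ≤ f (σ i)
    · simp [h]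
    · simp [h, w.2 i]
  right_inv v := by
    funext i
    simp [i.2]

theorem two_mul_card_le_involution {α : Type*} [DecidableEq α] [Fintype α] {f : α → ℕ}
    (hf : Function.Injective f) {σ : α → α} (hσ : Function.Involutive σ) :
    2 * #{i | f i ≤ f (σ i)} = Fintype.card α + #{i | σ i = i} := by
  have himg : #{i | f i ≤ f (σ i)} = #{i | f (σ i) ≤ f i} :=
    card_bij (fun i _ => σ i) (fun i hi => by simpa [hσ i] using hi)
      (fun _ _ _ _ h => hσ.injective h)
      (fun i hi => ⟨σ i, by simpa [hσ i] using hi, hσ i⟩)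
  have hunion : (univ.filter fun i => f i ≤ f (σ i)) ∪ (univ.filter fun i => f (σ i) ≤ f i) =
      univ := by
    ext i; simpa using le_total (f i) (f (σ i))
  have hinter : (univ.filter fun i => f i ≤ f (σ i)) ∩ (univ.filter fun i => f (σ i) ≤ f i) =
      univ.filter fun i => σ i = i := by
    ext i
    simp only [mem_inter, mem_filter, mem_univ, true_and]
    exact ⟨fun h => hf (le_antisymm h.2 h.1), fun h => by simp [h]⟩
  have h := card_union_add_card_inter (univ.filter fun i => f i ≤ f (σ i))
    (univ.filter fun i => f (σ i) ≤ f i)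
  rw [hunion, hinter, card_univ] at h
  omega

theorem card_reflectionFixed [NeZero n] (a : ZMod n) :
    Nat.card {w : ZMod n → Fin k // ∀ i, w (a - i) = w i} =
      k ^ ((n + #{i : ZMod n | i + i = a}) / 2) := by
  have hσ : Function.Involutive fun i : ZMod n => a - i := fun i => sub_sub_cancel a i
  rw [Nat.card_congr (involutionFixedEquiv (ZMod.val_injective n) hσ), Nat.card_fun, Nat.card_fin,
    Nat.card_eq_fintype_card, Fintype.card_subtype]
  have h := two_mul_card_le_involution (ZMod.val_injective n) hσ
  have hfix : (univ.filter fun i : ZMod n => a - i = i) = univ.filter fun i => i + i = a := by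
    ext i
    simp only [mem_filter, mem_univ, true_and]
    rw [sub_eq_iff_eq_add, eq_comm]
  rw [hfix, ZMod.card] at h
  congr 1
  omega

theorem card_double_eq_of_odd [NeZero n] (hn : Odd n) (a : ZMod n) :
    #{i : ZMod n | i + i = a} = 1 := by
  have hinj : Function.Injective fun i : ZMod n => i + i := by
    intro i j h
    have h0 : -(i - j) = i - j := by
      have h : i + i = j + j := h
      linear_combination -h
    rcases (ZMod.neg_eq_self_iff _).mp h0 with h1 | h1
    · exact sub_eq_zero.mp h1
    · exact absurd (h1 ▸ even_two_mul _) (Nat.not_even_iff_odd.mpr hn)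
  obtain ⟨j, hj⟩ := (Finite.injective_iff_surjective.mp hinj) a
  rw [card_eq_one]
  refine ⟨j, ?_⟩
  ext i
  simp only [mem_filter, mem_univ, true_and, mem_singleton]
  exact ⟨fun h => hinj (h.trans hj.symm), fun h => h ▸ hj⟩

theorem card_double_eq_of_even [NeZero n] (hn : Even n) (a : ZMod n) :
    #{i : ZMod n | i + i = a} = 0 ∨ #{i : ZMod n | i + i = a} = 2 := by
  rcases (univ.filter fun i : ZMod n => i + i = a).eq_empty_or_nonempty with h | ⟨j, hj⟩
  · exact Or.inl (card_eq_zero.mpr h)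
  right
  have hj : j + j = a := (mem_filter.mp hj).2
  obtain ⟨m, hm⟩ := hn
  have hmm : (m : ZMod n) + m = 0 := by
    rw [← Nat.cast_add, ← hm, ZMod.natCast_self]
  have hm0 : (m : ZMod n) ≠ 0 := by
    rw [Ne, ZMod.natCast_eq_zero_iff]
    intro h
    have hn0 := NeZero.ne n
    have := Nat.le_of_dvd (by omega) h
    omega
  rw [card_eq_two]
  refine ⟨j, j + m, by simpa using hm0, ?_⟩
  ext i
  simp only [mem_filter, mem_univ, true_and, mem_insert, mem_singleton]
  constructor
  · intro h
    have h0 : -(i - j) = i - j := by linear_combination hj - h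
    rcases (ZMod.neg_eq_self_iff _).mp h0 with h1 | h1
    · exact Or.inl (sub_eq_zero.mp h1)
    · right
      have hv : (i - j).val = m := by omega
      rw [← hv, ZMod.natCast_zmod_val, add_sub_cancel]
  · rintro (rfl | rfl)
    · exact hj
    · linear_combination hj + hmm

theorem sum_card_reflectionFixed_of_odd [NeZero n] (hn : Odd n) :
    ∑ a : ZMod n, Nat.card {w : ZMod n → Fin k // ∀ i, w (a - i) = w i} =
      n * k ^ ((n + 1) / 2) := by
  simp only [card_reflectionFixed, card_double_eq_of_odd hn]
  simp

theorem two_mul_sum_card_reflectionFixed_of_even [NeZero n] (hn : Even n) :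
    2 * ∑ a : ZMod n, Nat.card {w : ZMod n → Fin k // ∀ i, w (a - i) = w i} =
      n * ((k + 1) * k ^ (n / 2)) := by
  have hsum : ∑ a : ZMod n, #{i : ZMod n | i + i = a} = n := by
    rw [← card_eq_sum_card_fiberwise (s := univ) (t := univ) fun _ _ => by simp,
      card_univ, ZMod.card]
  have hterm : ∀ a : ZMod n, 2 * k ^ ((n + #{i : ZMod n | i + i = a}) / 2) =
      #{i : ZMod n | i + i = a} * k ^ (n / 2 + 1) +
        (2 - #{i : ZMod n | i + i = a}) * k ^ (n / 2) := by
    intro a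
    rcases card_double_eq_of_even hn a with h | h <;> simp [h]
  have hcompl : ∑ a : ZMod n, (2 - #{i : ZMod n | i + i = a}) = n := by
    have h2 : ∑ a : ZMod n, (#{i : ZMod n | i + i = a} + (2 - #{i : ZMod n | i + i = a})) =
        n * 2 := by
      rw [sum_congr rfl (g := fun _ => 2) fun a _ => by
        rcases card_double_eq_of_even hn a with h | h <;> simp [h]]
      simp
    rw [sum_add_distrib, hsum] at h2
    omega
  simp only [card_reflectionFixed]
  rw [mul_sum, sum_congr rfl fun a _ => hterm a, sum_add_distrib, ← sum_mul, ← sum_mul,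
    hsum, hcompl]
  ring

/-! ### Counting bracelets -/

/-- Elements of the dihedral group are rotations and reflections. -/
def dihedralEquivSum (n : ℕ) : ZMod n ⊕ ZMod n ≃ DihedralGroup n where
  toFun := Sum.elim .r .sr
  invFun
    | .r a => .inl a
    | .sr a => .inr a
  left_inv := by rintro (a | a) <;> rfl
  right_inv := by rintro (a | a) <;> rfl

theorem card_quot_mul_two_mul [NeZero n] :
    Nat.card (Quot (DihRel n k)) * (2 * n) =
      ∑ d ∈ n.divisors, d.totient * k ^ (n / d) +
        ∑ a : ZMod n, Nat.card {w : ZMod n → Fin k // ∀ i, w (a - i) = w i} := by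
  classical
  have : Fintype (Quotient (MulAction.orbitRel (DihedralGroup n) (ZMod n → Fin k))) :=
    Fintype.ofFinite _
  have h := MulAction.sum_card_fixedBy_eq_card_orbits_mul_card_group
    (DihedralGroup n) (ZMod n → Fin k)
  rw [DihedralGroup.card, ← Nat.card_eq_fintype_card,
    ← Nat.card_congr (quotEquivOrbits n k)] at h
  rw [← h, ← (dihedralEquivSum n).sum_comp, Fintype.sum_sum_type, ← sum_card_shiftFixed]
  simp only [← Nat.card_eq_fintype_card]
  congr 1 <;> exact sum_congr rfl fun a _ =>
    Nat.card_congr (Equiv.subtypeEquivRight fun w => funext_iff)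

theorem card_quot_eq_Bq [NeZero n] : (Nat.card (Quot (DihRel n k)) : ℚ) = Bq k n := by
  have hn : (n : ℚ) ≠ 0 := Nat.cast_ne_zero.mpr (NeZero.ne n)
  have h := congrArg (Nat.cast (R := ℚ)) (card_quot_mul_two_mul (n := n) (k := k))
  push_cast at h
  unfold Bq Nq
  split_ifs with he
  · have h2 := congrArg (Nat.cast (R := ℚ)) (two_mul_sum_card_reflectionFixed_of_even (k := k) he)
    push_cast at h2
    field_simp
    linear_combination 2 * h + h2
  · have h2 := congrArg (Nat.cast (R := ℚ))
      (sum_card_reflectionFixed_of_odd (k := k) (Nat.not_even_iff_odd.mp he))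
    push_cast at h2
    field_simp
    linear_combination h + h2

/-! ### Bracelets by minimal period -/

/-- The subgroup of shifts that fix a word. -/
def periods (w : ZMod n → Fin k) : AddSubgroup (ZMod n) where
  carrier := {ℓ | ∀ i, w (i + ℓ) = w i}
  zero_mem' i := by rw [add_zero]
  add_mem' {a b} ha hb i := by rw [← add_assoc, hb, ha]
  neg_mem' {a} ha i := by rw [← ha (i + -a), neg_add_cancel_right]

theorem mem_periods {w : ZMod n → Fin k} {ℓ : ZMod n} :
    ℓ ∈ periods w ↔ ∀ i, w (i + ℓ) = w i := Iff.rfl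

theorem periods_smul_le (g : DihedralGroup n) (w : ZMod n → Fin k) :
    periods w ≤ periods (g • w) := by
  intro ℓ hℓ
  rcases g with a | a
  · intro i
    rw [r_smul_apply, r_smul_apply, add_right_comm]
    exact hℓ _
  · intro i
    rw [sr_smul_apply, sr_smul_apply, ← sub_sub, sub_eq_add_neg (a - i)]
    exact (neg_mem hℓ) _

theorem periods_smul (g : DihedralGroup n) (w : ZMod n → Fin k) :
    periods (g • w) = periods w := by
  refine le_antisymm ?_ (periods_smul_le g w)
  simpa using periods_smul_le g⁻¹ (g • w)

/-- The minimal period of a bracelet. -/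
noncomputable def minPeriod [NeZero n] : Quot (DihRel n k) → ℕ :=
  Quot.lift (fun w => (periods w).index) fun _ _ h => by
    obtain ⟨g, rfl⟩ := mk_eq_mk_iff.mp (Quot.sound h)
    exact congrArg AddSubgroup.index (periods_smul g _)

theorem minPeriod_dvd [NeZero n] (o : Quot (DihRel n k)) : minPeriod o ∣ n := by
  induction o using Quot.ind with
  | mk w =>
    have h := AddSubgroup.index_dvd_card (periods w)
    rwa [Nat.card_zmod] at h

theorem aperiodicWord_iff [NeZero n] {w : ZMod n → Fin k} :
    AperiodicWord n k w ↔ (periods w).index = n := by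
  have hcard := (periods w).card_mul_index
  rw [Nat.card_zmod] at hcard
  have hbot : AperiodicWord n k w ↔ periods w = ⊥ := (AddSubgroup.eq_bot_iff_forall (periods w)).symm
  rw [hbot]
  constructor
  · intro h
    rw [h, AddSubgroup.index_bot, Nat.card_zmod]
  · intro h
    rw [h] at hcard
    exact AddSubgroup.eq_bot_of_card_eq _
      (Nat.eq_of_mul_eq_mul_right (NeZero.pos n) (hcard.trans (one_mul n).symm))

theorem lyndonBraceletCount_eq [NeZero n] :
    lyndonBraceletCount n k = Nat.card {o : Quot (DihRel n k) // minPeriod o = n} := by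
  have hset : {o : Quot (DihRel n k) |
      ∀ w : ZMod n → Fin k, Quot.mk (DihRel n k) w = o → AperiodicWord n k w} =
      {o | minPeriod o = n} := by
    ext o
    constructor
    · intro h
      induction o using Quot.ind with
      | mk w => exact aperiodicWord_iff.mp (h w rfl)
    · rintro h w rfl
      exact aperiodicWord_iff.mpr h
  rw [lyndonBraceletCount, hset]
  rfl

variable {d : ℕ}

/-- The word of length `n` that repeats a word of length `d ∣ n`. -/
def repeatWord (hd : d ∣ n) (v : ZMod d → Fin k) : ZMod n → Fin k :=
  v ∘ ZMod.castHom hd (ZMod d)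

theorem periods_repeatWord (hd : d ∣ n) (v : ZMod d → Fin k) :
    periods (repeatWord hd v) =
      (periods v).comap (ZMod.castHom hd (ZMod d) : ZMod n →+ ZMod d) := by
  ext ℓ
  simp only [mem_periods, AddSubgroup.mem_comap, repeatWord, Function.comp_apply, map_add]
  exact ((ZMod.castHom_surjective hd).forall (p := fun j =>
    v (j + ZMod.castHom hd (ZMod d) ℓ) = v j)).symm

theorem index_periods_repeatWord (hd : d ∣ n) (v : ZMod d → Fin k) :
    (periods (repeatWord hd v)).index = (periods v).index := by
  rw [periods_repeatWord]
  exact AddSubgroup.index_comap_of_surjective _ (ZMod.castHom_surjective hd)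

theorem orbitRel_repeatWord_iff (hd : d ∣ n) {v v' : ZMod d → Fin k} :
    MulAction.orbitRel (DihedralGroup n) (ZMod n → Fin k) (repeatWord hd v) (repeatWord hd v') ↔
      MulAction.orbitRel (DihedralGroup d) (ZMod d → Fin k) v v' := by
  have hsurj := ZMod.castHom_surjective hd
  constructor
  · rintro ⟨a | a, h⟩
    · refine ⟨.r (ZMod.castHom hd (ZMod d) a), funext (hsurj.forall.mpr fun i => ?_)⟩
      simpa only [r_smul_apply, repeatWord, Function.comp_apply, map_add] using congrFun h i
    · refine ⟨.sr (ZMod.castHom hd (ZMod d) a), funext (hsurj.forall.mpr fun i => ?_)⟩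
      simpa only [sr_smul_apply, repeatWord, Function.comp_apply, map_sub] using congrFun h i
  · rintro ⟨a | a, rfl⟩ <;> obtain ⟨b, rfl⟩ := hsurj a
    · exact ⟨.r b, funext fun i => by
        simp only [r_smul_apply, repeatWord, Function.comp_apply, map_add]⟩
    · exact ⟨.sr b, funext fun i => by
        simp only [sr_smul_apply, repeatWord, Function.comp_apply, map_sub]⟩

theorem exists_repeatWord_eq [NeZero n] (hd : d ∣ n) {w : ZMod n → Fin k}
    (hw : (periods w).index = d) : ∃ v, repeatWord hd v = w := by
  have hsurj := ZMod.castHom_surjective hd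
  refine ⟨w ∘ Function.surjInv hsurj, funext fun i => ?_⟩
  set j := Function.surjInv hsurj (ZMod.castHom hd (ZMod d) i) with hj
  have hij : ZMod.castHom hd (ZMod d) (j - i) = 0 := by
    rw [map_sub, hj, Function.surjInv_eq hsurj, sub_self]
  rw [← ZMod.natCast_zmod_val (j - i), map_natCast, ZMod.natCast_eq_zero_iff] at hij
  obtain ⟨q, hq⟩ := hij
  have hmem : j - i ∈ periods w := by
    have h := (periods w).nsmul_index_mem (q : ZMod n)
    rwa [hw, nsmul_eq_mul, ← Nat.cast_mul, ← hq, ZMod.natCast_zmod_val] at h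
  have h := hmem i
  rwa [add_sub_cancel] at h

theorem card_minPeriod_eq [NeZero n] (hd : d ∣ n) :
    Nat.card {o : Quot (DihRel n k) // minPeriod o = d} = lyndonBraceletCount d k := by
  have : NeZero d := ⟨ne_zero_of_dvd_ne_zero (NeZero.ne n) hd⟩
  rw [lyndonBraceletCount_eq]
  let F : Quot (DihRel d k) → Quot (DihRel n k) :=
    Quot.lift (fun v => Quot.mk _ (repeatWord hd v)) fun _ _ h =>
      mk_eq_mk_iff.mpr ((orbitRel_repeatWord_iff hd).mpr (mk_eq_mk_iff.mp (Quot.sound h)))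
  have hF : ∀ o, minPeriod (F o) = minPeriod o := by
    rintro ⟨v⟩
    exact index_periods_repeatWord hd v
  refine (Nat.card_congr (Equiv.ofBijective
    (fun o : {o : Quot (DihRel d k) // minPeriod o = d} =>
      (⟨F o, (hF o).trans o.2⟩ : {o : Quot (DihRel n k) // minPeriod o = d})) ⟨?_, ?_⟩)).symm
  · rintro ⟨⟨v⟩, hv⟩ ⟨⟨v'⟩, hv'⟩ h
    exact Subtype.ext (mk_eq_mk_iff.mpr ((orbitRel_repeatWord_iff hd).mp
      (mk_eq_mk_iff.mp (congrArg Subtype.val h))))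
  · rintro ⟨⟨w⟩, hw⟩
    obtain ⟨v, rfl⟩ := exists_repeatWord_eq hd hw
    exact ⟨⟨Quot.mk _ v, (index_periods_repeatWord hd v).symm.trans hw⟩, rfl⟩

theorem card_quot_eq_sum_lyndonBraceletCount [NeZero n] :
    Nat.card (Quot (DihRel n k)) = ∑ d ∈ n.divisors, lyndonBraceletCount d k := by
  classical
  have : Fintype (Quot (DihRel n k)) := Fintype.ofFinite _
  rw [Nat.card_eq_fintype_card, ← card_univ,
    card_eq_sum_card_fiberwise (f := minPeriod) (t := n.divisors)
      fun o _ => Nat.mem_divisors.mpr ⟨minPeriod_dvd o, NeZero.ne n⟩]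
  refine sum_congr rfl fun d hd => ?_
  rw [← card_minPeriod_eq (Nat.dvd_of_mem_divisors hd), Nat.card_eq_fintype_card,
    Fintype.card_subtype]

theorem sum_lyndonBraceletCount (n k : ℕ) (hn : 0 < n) :
    ∑ d ∈ n.divisors, (lyndonBraceletCount d k : ℚ) = Bq k n := by
  have : NeZero n := ⟨hn.ne'⟩
  rw [← card_quot_eq_Bq, card_quot_eq_sum_lyndonBraceletCount, Nat.cast_sum]

end Bracelet

/-- The number of Lyndon (primitive) bracelets of length `n` equals
`BL_k(n) = ∑_{d ∣ n} μ(d) B_k(n/d)`; equivalently, `B_k(n) = ∑_{d ∣ n} BL_k(d)`. -/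
theorem lyndon_bracelet_count (n k : ℕ) (hn : 1 ≤ n) (hk : 1 ≤ k) :
    (lyndonBraceletCount n k : ℚ) =
      ∑ d ∈ n.divisors, (ArithmeticFunction.moebius d : ℚ) * Bq k (n / d) ∧
    Bq k n = ∑ d ∈ n.divisors, (lyndonBraceletCount d k : ℚ) := by
  refine ⟨?_, (Bracelet.sum_lyndonBraceletCount n k hn).symm⟩
  have h := ArithmeticFunction.sum_eq_iff_sum_mul_moebius_eq.mp
    (fun m hm => Bracelet.sum_lyndonBraceletCount m k hm) n hn
  rw [← h, Nat.sum_divisorsAntidiagonal fun i j =>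
    (ArithmeticFunction.moebius i : ℚ) * Bq k j]
end
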